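/- arXiv:1108.5082 — 6 statements merged into one kernel-verified Lean document; each statement's English description precedes it below -/
import Mathlib

section
/- Let (S,ρ,μ) be a metric measure space, let T > 0, let p be a substochastic transition function on S, and fix x₀ ∈ S. Suppose there are constants a, b, C, ε > 0 such that for every y ∈ S and every τ ∈ (0,ε) one has ∫_S ρ(z,y)^a · p_τ(z,y) dμ(z) ≤ C·τ^{1+b}. Then there exist a measure space (Ω,𝓐,P) with P(Ω) ≤ 1 and a family of measurable maps Y_t : Ω → S, t ∈ [0,T], such that: (i) Y₀(ω) = x₀ for all ω ∈ Ω; (ii) for every n ∈ ℕ, all 0 < t₁ < … < tₙ = T and every Borel set B ⊂ Sⁿ, P({ω ∈ Ω : (Y_{t₁}(ω),…,Y_{tₙ}(ω)) ∈ B}) = ∫_{Sⁿ} 1_B(x₁,…,xₙ) p_{tₙ−tₙ₋₁}(xₙ,xₙ₋₁)⋯p_{t₂−t₁}(x₂,x₁) p_{t₁}(x₁,x₀) dμ(x₁)⋯dμ(xₙ); (iii) for every ω ∈ Ω and every θ ∈ (0, b/a), the path t ↦ Y_t(ω) is Hölder continuous of order θ. -/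
open MeasureTheory Filter Topology
open scoped ENNReal NNReal

noncomputable section

/-- Extend a finite tuple `x : Fin n → S` to a map `ℕ → S` starting at `x₀`,
so that `pathOf x₀ n x 0 = x₀` and `pathOf x₀ n x (i+1) = x i` for `i < n`. -/
def pathOf {S : Type*} (x₀ : S) (n : ℕ) (x : Fin n → S) : ℕ → S :=
  fun i => if h : 0 < i ∧ i - 1 < n then x ⟨i - 1, h.2⟩ else x₀

section KolmogorovExtension

variable {ι S : Type*} [TopologicalSpace S] [PolishSpace S]

/-- Cylinders over compact bases with the finite intersection property have a common point. -/
theorem nonempty_iInter_cylinder_of_isCompact {J : ℕ → Finset ι}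
    {K : ∀ n, Set (J n → S)} (hK : ∀ n, IsCompact (K n))
    (hne : ∀ n, (⋂ i ≤ n, cylinder (α := fun _ => S) (J i) (K i)).Nonempty) :
    (⋂ n, cylinder (α := fun _ => S) (J n) (K n)).Nonempty := by
  choose y hy using hne
  have hyK (i : ℕ) : ∀ᶠ n in (hyperfilter ℕ : Filter ℕ), (J i).restrict (y n) ∈ K i := by
    refine (Nat.hyperfilter_le_atTop) ?_
    filter_upwards [eventually_ge_atTop i] with n hn
    exact Set.mem_iInter₂.1 (hy n) i hn
  have hlim (i : ℕ) : ∃ z ∈ K i,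
      Tendsto (fun n => (J i).restrict (y n)) (hyperfilter ℕ : Filter ℕ) (𝓝 z) := by
    have := (hK i).ultrafilter_le_nhds ((hyperfilter ℕ).map fun n => (J i).restrict (y n))
      (le_principal_iff.2 (hyK i))
    exact this
  choose z hzK hz using hlim
  have hcoord (i : ℕ) (j : J i) :
      Tendsto (fun n => y n j) (hyperfilter ℕ : Filter ℕ) (𝓝 (z i j)) :=
    tendsto_pi_nhds.1 (hz i) j
  classical
  let w : ι → S := fun j => if h : ∃ i, j ∈ J i then z h.choose ⟨j, h.choose_spec⟩ else y 0 j
  refine ⟨w, Set.mem_iInter.2 fun i => ?_⟩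
  have : (J i).restrict w = z i := by
    ext j
    have h : ∃ i, (j : ι) ∈ J i := ⟨i, j.2⟩
    have hw : w j = z h.choose ⟨j, h.choose_spec⟩ := dif_pos h
    rw [Finset.restrict, hw]
    exact tendsto_nhds_unique (hcoord _ ⟨j, h.choose_spec⟩) (hcoord i j)
  rw [mem_cylinder, this]
  exact hzK i

variable [MeasurableSpace S] [BorelSpace S] {P : ∀ J : Finset ι, Measure (J → S)}

theorem projectiveFamilyContent_tendsto_zero [∀ J, IsFiniteMeasure (P J)]
    (hP : IsProjectiveMeasureFamily (α := fun _ => S) P) {A : ℕ → Set (ι → S)}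
    (hA : ∀ n, A n ∈ measurableCylinders fun _ : ι => S) (hanti : Antitone A)
    (hinter : ⋂ n, A n = ∅) :
    Tendsto (fun n => projectiveFamilyContent hP (A n)) atTop (𝓝 0) := by
  have hmono : Antitone fun n => projectiveFamilyContent hP (A n) :=
    fun i j hij => projectiveFamilyContent_mono hP (hA j) (hA i) (hanti hij)
  have hlim := tendsto_atTop_iInf hmono
  by_cases hδ : ⨅ n, projectiveFamilyContent hP (A n) = 0
  · rwa [hδ] at hlim
  exfalso
  choose J B hB hAB using fun n => (mem_measurableCylinders _).1 (hA n)
  obtain ⟨η, hη, hηsum⟩ := ENNReal.exists_pos_sum_of_countable' hδ ℕ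
  choose K hKB hK hKm using fun n => (hB n).exists_isCompact_sdiff_lt
    (measure_ne_top (P (J n)) _) (hη n).ne'
  have hKmeas n : MeasurableSet (K n) := (hK n).isClosed.measurableSet
  have hdiff n : A n \ cylinder (J n) (K n) = cylinder (J n) (B n \ K n) := by
    rw [hAB n, sdiff_cylinder_same]
  have hdiffmem n : A n \ cylinder (J n) (K n) ∈ measurableCylinders fun _ : ι => S := by
    rw [hdiff]
    exact cylinder_mem_measurableCylinders _ _ ((hB n).diff (hKmeas n))
  have hne n : (⋂ i ≤ n, cylinder (α := fun _ => S) (J i) (K i)).Nonempty := by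
    by_contra hempty
    rw [Set.not_nonempty_iff_eq_empty] at hempty
    have hsub : A n ⊆ ⋃ i ≤ n, A i \ cylinder (J i) (K i) := by
      intro x hx
      by_contra hx'
      simp only [Set.mem_iUnion, not_exists, Set.mem_sdiff, not_and, not_not] at hx'
      have : x ∈ ⋂ i ≤ n, cylinder (α := fun _ => S) (J i) (K i) :=
        Set.mem_iInter₂.2 fun i hi => hx' i hi (hanti hi hx)
      simp [hempty] at this
    have hUmem : ⋃ i ≤ n, A i \ cylinder (J i) (K i) ∈ measurableCylinders fun _ : ι => S := by
      have := isSetRing_measurableCylinders.biUnion_mem (Finset.range (n + 1))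
        (fun i _ => hdiffmem i)
      simpa [Nat.lt_succ_iff] using this
    have h1 : projectiveFamilyContent hP (A n) ≤ ∑ i ∈ Finset.range (n + 1), η i := by
      refine (projectiveFamilyContent_mono hP (hA n) hUmem hsub).trans
        ((projectiveFamilyContent_iUnion_le hP hdiffmem n).trans (Finset.sum_le_sum fun i _ => ?_))
      rw [hdiff, projectiveFamilyContent_cylinder hP ((hB i).diff (hKmeas i))]
      exact (hKm i).le
    exact absurd ((iInf_le _ n).trans (h1.trans (ENNReal.sum_le_tsum _))) (not_le.2 hηsum)
  obtain ⟨w, hw⟩ := nonempty_iInter_cylinder_of_isCompact hK hne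
  have : w ∈ ⋂ n, A n := by
    refine Set.mem_iInter.2 fun n => ?_
    rw [hAB n]
    exact hKB n (Set.mem_iInter.1 hw n)
  simp [hinter] at this

/-- **Kolmogorov extension theorem** for finite measures on a Polish space. -/
theorem exists_isProjectiveLimit [∀ J, IsFiniteMeasure (P J)]
    (hP : IsProjectiveMeasureFamily (α := fun _ => S) P) :
    ∃ ν : Measure (ι → S), IsProjectiveLimit ν P := by
  have hsub : (projectiveFamilyContent hP).IsSigmaSubadditive :=
    isSigmaSubadditive_of_addContent_iUnion_eq_tsum isSetRing_measurableCylinders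
      fun f hf hfU hdisj => addContent_iUnion_eq_sum_of_tendsto_zero isSetRing_measurableCylinders
        (projectiveFamilyContent hP) (fun _ _ => projectiveFamilyContent_ne_top hP)
        (fun _ hs anti inter => projectiveFamilyContent_tendsto_zero hP hs anti inter) hf hfU hdisj
  refine ⟨(projectiveFamilyContent hP).measure isSetSemiring_measurableCylinders
    generateFrom_measurableCylinders.ge hsub, fun J => ?_⟩
  ext A hA
  rw [Measure.map_apply (Finset.measurable_restrict J) hA, AddContent.measure_eq,
    projectiveFamilyContent_congr hP (J.restrict ⁻¹' A) rfl hA]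
  · exact generateFrom_measurableCylinders.symm
  · exact cylinder_mem_measurableCylinders _ _ hA

end KolmogorovExtension

section FiniteDimensionalLaws

variable {S : Type*} [MeasurableSpace S]

/-- The law of a path obtained from `ω` by successively resampling its values at the times of the
list `l`, using the transition densities `p` with respect to `μ`, starting from `x` at time `s`. -/
def resampleLaw (μ : Measure S) (p : ℝ → S → S → ℝ≥0∞) :
    List ℝ → ℝ → S → (ℝ → S) → Measure (ℝ → S)
  | [], _, _, ω => Measure.dirac ω
  | t :: l, s, x, ω => (μ.withDensity fun y => p (t - s) y x).bind
      fun y => resampleLaw μ p l t y (Function.update ω t y)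

variable {μ : Measure S} {p : ℝ → S → S → ℝ≥0∞}

theorem measurable_resample_step {l : List ℝ} {t : ℝ}
    (h : Measurable fun q : S × (ℝ → S) => resampleLaw μ p l t q.1 q.2) (ω : ℝ → S) :
    Measurable fun y => resampleLaw μ p l t y (Function.update ω t y) :=
  h.comp (measurable_id.prodMk (measurable_update ω))

variable [SigmaFinite μ]

theorem measurable_resampleLaw (hp : ∀ t, Measurable (Function.uncurry (p t))) (l : List ℝ)
    (s : ℝ) : Measurable fun q : S × (ℝ → S) => resampleLaw μ p l s q.1 q.2 := by
  induction l generalizing s with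
  | nil => exact Measure.measurable_dirac.comp measurable_snd
  | cons t l ih =>
    refine Measure.measurable_of_measurable_coe _ fun A hA => ?_
    have h (q : S × (ℝ → S)) : resampleLaw μ p (t :: l) s q.1 q.2 A =
        ∫⁻ y, p (t - s) y q.1 * resampleLaw μ p l t y (Function.update q.2 t y) A ∂μ := by
      rw [resampleLaw, Measure.bind_apply hA (measurable_resample_step (ih t) _).aemeasurable,
        lintegral_withDensity_eq_lintegral_mul _ (hp _).of_uncurry_right
          (g := fun y => resampleLaw μ p l t y (Function.update q.2 t y) A)
          ((Measure.measurable_coe hA).comp (measurable_resample_step (ih t) _))]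
      rfl
    simp_rw [h]
    refine Measurable.lintegral_prod_right' (f := fun z : (S × (ℝ → S)) × S =>
      p (t - s) z.2 z.1.1 * resampleLaw μ p l t z.2 (Function.update z.1.2 t z.2) A) ?_
    refine ((hp (t - s)).comp (measurable_snd.prodMk measurable_fst.fst)).mul ?_
    exact (Measure.measurable_coe hA).comp ((ih t).comp
      (measurable_snd.prodMk (measurable_update'.comp (measurable_fst.snd.prodMk measurable_snd))))

theorem lintegral_resampleLaw_cons (hp : ∀ t, Measurable (Function.uncurry (p t)))
    (t : ℝ) (l : List ℝ) (s : ℝ) (x : S) (ω : ℝ → S) {f : (ℝ → S) → ℝ≥0∞} (hf : Measurable f) :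
    ∫⁻ w, f w ∂resampleLaw μ p (t :: l) s x ω = ∫⁻ y, p (t - s) y x *
      ∫⁻ w, f w ∂resampleLaw μ p l t y (Function.update ω t y) ∂μ := by
  have hm := measurable_resample_step (measurable_resampleLaw (μ := μ) hp l t) ω
  rw [resampleLaw, Measure.lintegral_bind hm.aemeasurable hf.aemeasurable,
    lintegral_withDensity_eq_lintegral_mul _ (hp _).of_uncurry_right
      (g := fun y => ∫⁻ w, f w ∂resampleLaw μ p l t y (Function.update ω t y))
      ((Measure.measurable_lintegral hf).comp hm)]
  rfl

theorem resampleLaw_univ_le (hp : ∀ t, Measurable (Function.uncurry (p t)))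
    (hsub : ∀ t x, ∫⁻ y, p t y x ∂μ ≤ 1) (l : List ℝ) (s : ℝ) (x : S) (ω : ℝ → S) :
    resampleLaw μ p l s x ω Set.univ ≤ 1 := by
  induction l generalizing s x ω with
  | nil => simp [resampleLaw]
  | cons t l ih =>
    rw [← lintegral_one, lintegral_resampleLaw_cons hp t l s x ω measurable_const]
    refine (lintegral_mono fun y => ?_).trans (hsub (t - s) x)
    simpa using mul_le_mul_right (ih t y (Function.update ω t y)) (p (t - s) y x)

/-- A time that is not resampled keeps its value. -/
theorem ae_resampleLaw_eq [MeasurableSingletonClass S]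
    (hp : ∀ t, Measurable (Function.uncurry (p t))) {l : List ℝ} {u : ℝ} (hu : u ∉ l) (s : ℝ)
    (x : S) (ω : ℝ → S) : ∀ᵐ w ∂resampleLaw μ p l s x ω, w u = ω u := by
  have hA (c : S) : MeasurableSet {w : ℝ → S | ¬ w u = c} :=
    (measurable_pi_apply (X := fun _ : ℝ => S) u (measurableSet_singleton c)).compl
  induction l generalizing s x ω with
  | nil => rw [ae_iff, resampleLaw, Measure.dirac_apply' _ (hA _)]; simp
  | cons t l ih =>
    rw [List.mem_cons, not_or] at hu
    rw [ae_iff, ← lintegral_indicator_one (hA _), lintegral_resampleLaw_cons hp t l s x ω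
      (measurable_one.indicator (hA _))]
    refine lintegral_eq_zero_of_ae_eq_zero (Eventually.of_forall fun y => ?_)
    have := ih hu.2 t y (Function.update ω t y)
    rw [Function.update_of_ne hu.1, ae_iff] at this
    simp [lintegral_indicator_one (hA _), this]

/-- Changing the initial path at a time on which the integrand does not depend has no effect. -/
theorem lintegral_resampleLaw_update (hp : ∀ t, Measurable (Function.uncurry (p t)))
    {f : (ℝ → S) → ℝ≥0∞} (hf : Measurable f) {u : ℝ}
    (hfu : ∀ w y, f (Function.update w u y) = f w) {l : List ℝ} (hu : u ∉ l) (s : ℝ) (x : S)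
    (ω : ℝ → S) (y : S) :
    ∫⁻ w, f w ∂resampleLaw μ p l s x (Function.update ω u y) =
      ∫⁻ w, f w ∂resampleLaw μ p l s x ω := by
  induction l generalizing s x ω with
  | nil => simp [resampleLaw, lintegral_dirac' _ hf, hfu]
  | cons t l ih =>
    rw [List.mem_cons, not_or] at hu
    simp_rw [lintegral_resampleLaw_cons hp t l s x _ hf,
      Function.update_comm (β := fun _ : ℝ => S) hu.1 y, ih hu.2]

/-- The Chapman–Kolmogorov identity: the first resampled time can be dropped when the integrand
does not depend on it. -/
theorem lintegral_resampleLaw_cons_cons (hp : ∀ t, Measurable (Function.uncurry (p t)))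
    {f : (ℝ → S) → ℝ≥0∞} (hf : Measurable f) {s t u : ℝ}
    (hft : ∀ w y, f (Function.update w t y) = f w)
    (hCK : ∀ x z, ∫⁻ y, p (u - t) z y * p (t - s) y x ∂μ = p (u - s) z x)
    {l : List ℝ} (ht : t ∉ u :: l) (x : S) (ω : ℝ → S) :
    ∫⁻ w, f w ∂resampleLaw μ p (t :: u :: l) s x ω =
      ∫⁻ w, f w ∂resampleLaw μ p (u :: l) s x ω := by
  let F : S → ℝ≥0∞ := fun z => ∫⁻ w, f w ∂resampleLaw μ p l u z (Function.update ω u z)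
  have hF : Measurable F := (Measure.measurable_lintegral hf).comp
    (measurable_resample_step (measurable_resampleLaw hp l u) ω)
  have hprod : Measurable fun q : S × S => p (t - s) q.1 x * (p (u - t) q.2 q.1 * F q.2) :=
    ((hp _).comp (measurable_fst.prodMk measurable_const)).mul
      (((hp _).comp measurable_swap).mul (hF.comp measurable_snd))
  simp_rw [lintegral_resampleLaw_cons hp t _ s x ω hf, lintegral_resampleLaw_update hp hf hft ht,
    lintegral_resampleLaw_cons hp u l _ _ ω hf]
  change ∫⁻ y, p (t - s) y x * ∫⁻ z, p (u - t) z y * F z ∂μ ∂μ = ∫⁻ z, p (u - s) z x * F z ∂μ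
  calc ∫⁻ y, p (t - s) y x * ∫⁻ z, p (u - t) z y * F z ∂μ ∂μ
      = ∫⁻ y, ∫⁻ z, p (t - s) y x * (p (u - t) z y * F z) ∂μ ∂μ := by
        refine lintegral_congr fun y => (lintegral_const_mul _ ?_).symm
        exact (hp _).of_uncurry_right.mul hF
    _ = ∫⁻ z, ∫⁻ y, p (t - s) y x * (p (u - t) z y * F z) ∂μ ∂μ :=
        lintegral_lintegral_swap hprod.aemeasurable
    _ = ∫⁻ z, p (u - s) z x * F z ∂μ := by
        refine lintegral_congr fun z => ?_
        rw [← hCK, ← lintegral_mul_const (f := fun y => p (u - t) z y * p (t - s) y x) _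
          ((hp _).of_uncurry_left.mul (hp _).of_uncurry_right)]
        exact lintegral_congr fun y => by ring

theorem lintegral_resampleLaw_sublist (hp : ∀ t, Measurable (Function.uncurry (p t))) {T : ℝ}
    (hCK : ∀ s t : ℝ, 0 < s → 0 < t → s + t ≤ T →
      ∀ x z : S, ∫⁻ y, p t z y * p s y x ∂μ = p (t + s) z x)
    {f : (ℝ → S) → ℝ≥0∞} (hf : Measurable f) {l₁ l₂ : List ℝ} (hl : l₁.Sublist l₂) {s : ℝ}
    (hs : 0 ≤ s) (hpair : (s :: (l₂ ++ [T])).Pairwise (· < ·))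
    (hfu : ∀ t ∈ l₂, t ∉ l₁ → ∀ w y, f (Function.update w t y) = f w) (x : S) (ω : ℝ → S) :
    ∫⁻ w, f w ∂resampleLaw μ p (l₂ ++ [T]) s x ω =
      ∫⁻ w, f w ∂resampleLaw μ p (l₁ ++ [T]) s x ω := by
  induction hl generalizing s x ω with
  | slnil => rfl
  | @cons l₁ l₂ a hl ih =>
    simp only [List.cons_append] at hpair ⊢
    have hpa := List.pairwise_cons.1 (List.pairwise_cons.1 hpair).2
    have hsa : s < a := (List.pairwise_cons.1 hpair).1 a (by simp)
    have ha2 : a ∉ l₂ ++ [T] := fun h => lt_irrefl _ (hpa.1 a h)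
    have ha1 : a ∉ l₁ := fun h => ha2 (List.mem_append_left _ (hl.subset h))
    rw [← ih hs (hpair.sublist ((List.sublist_cons_self _ _).cons_cons _))
      (fun t ht => hfu t (List.mem_cons_of_mem _ ht))]
    obtain ⟨u, l', hu⟩ : ∃ u l', l₂ ++ [T] = u :: l' :=
      List.exists_cons_of_ne_nil (by simp)
    have huT : u ≤ T := by
      rcases l₂ with _ | ⟨c, l₂⟩
      · simp at hu; exact hu.1.ge
      · simp only [List.cons_append, List.cons.injEq] at hu
        have := (List.pairwise_cons.1 hpa.2).1 T (by simp)
        exact (hu.1 ▸ this).le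
    have hau : a < u := hpa.1 u (by simp [hu])
    rw [hu] at ha2 ⊢
    refine lintegral_resampleLaw_cons_cons hp hf (hfu a (by simp) ha1) (fun x z => ?_) ha2 x ω
    rw [hCK (a - s) (u - a) (by linarith) (by linarith) (by linarith)]
    congr 1
    ring
  | @cons_cons l₁ l₂ a hl ih =>
    simp only [List.cons_append] at hpair ⊢
    have hpa := (List.pairwise_cons.1 hpair).2
    have hsa : s < a := (List.pairwise_cons.1 hpair).1 a (by simp)
    rw [lintegral_resampleLaw_cons hp a _ s x ω hf, lintegral_resampleLaw_cons hp a _ s x ω hf]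
    refine lintegral_congr fun y => ?_
    rw [ih (hs.trans hsa.le) hpa]
    intro t ht ht1
    refine hfu t (List.mem_cons_of_mem _ ht) ?_
    have : a < t := (List.pairwise_cons.1 hpa).1 t (by simp [ht])
    simp [ht1, this.ne']

theorem measurable_prod_pathOf (hp : ∀ t, Measurable (Function.uncurry (p t))) (t : ℕ → ℝ)
    (x : S) (n : ℕ) : Measurable fun z : Fin n → S => ∏ i ∈ Finset.range n,
      p (t (i + 1) - t i) (pathOf x n z (i + 1)) (pathOf x n z i) := by
  have hpm (i : ℕ) : Measurable fun z : Fin n → S => pathOf x n z i := by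
    unfold pathOf
    split_ifs
    · exact measurable_pi_apply _
    · exact measurable_const
  exact Finset.measurable_prod _ fun i _ => (hp _).comp ((hpm (i + 1)).prodMk (hpm i))

theorem lintegral_pi_fin_succ {n : ℕ} {G : (Fin (n + 1) → S) → ℝ≥0∞} (hG : Measurable G) :
    ∫⁻ z, G z ∂(Measure.pi fun _ : Fin (n + 1) => μ) =
      ∫⁻ y, ∫⁻ z, G (Fin.cons y z) ∂(Measure.pi fun _ : Fin n => μ) ∂μ := by
  let e := MeasurableEquiv.piFinSuccAbove (fun _ : Fin (n + 1) => S) 0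
  rw [← ((measurePreserving_piFinSuccAbove (fun _ : Fin (n + 1) => μ) 0).symm).lintegral_comp hG]
  refine (lintegral_prod (μ := μ) (ν := Measure.pi fun _ : Fin n => μ)
    (fun q => G (e.symm q)) (hG.comp e.symm.measurable).aemeasurable).trans
    (lintegral_congr fun y => lintegral_congr fun z => ?_)
  simp [e, MeasurableEquiv.piFinSuccAbove_symm_apply, Fin.insertNthEquiv]

theorem lt_of_forall_lt_succ {n : ℕ} {t : ℕ → ℝ} (ht : ∀ i < n, t i < t (i + 1)) :
    ∀ j ≤ n, ∀ i < j, t i < t j := by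
  intro j hj
  induction j with
  | zero => simp
  | succ j ihj =>
    intro i hi
    rcases Nat.lt_succ_iff_lt_or_eq.1 hi with h | rfl
    · exact (ihj (by omega) i h).trans (ht j (by omega))
    · exact ht i (by omega)

/-- The finite-dimensional laws as explicit integrals. -/
theorem lintegral_resampleLaw_ofFn [MeasurableSingletonClass S]
    (hp : ∀ t, Measurable (Function.uncurry (p t)))
    {n : ℕ} {t : ℕ → ℝ} (ht : ∀ i < n, t i < t (i + 1)) (x : S) (ω : ℝ → S)
    {g : (Fin n → S) → ℝ≥0∞} (hg : Measurable g) :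
    ∫⁻ w, g (fun i => w (t (i.1 + 1))) ∂resampleLaw μ p
      (List.ofFn fun i : Fin n => t (i.1 + 1)) (t 0) x ω =
    ∫⁻ z, g z * ∏ i ∈ Finset.range n, p (t (i + 1) - t i) (pathOf x n z (i + 1)) (pathOf x n z i)
      ∂(Measure.pi fun _ : Fin n => μ) := by
  induction n generalizing t x ω with
  | zero =>
    have hc : ∀ z : Fin 0 → S, g z = g Fin.elim0 := fun z => by congr 1; ext i; exact i.elim0
    simp only [hc]
    simp [resampleLaw]
  | succ n ih =>
    have hmono := lt_of_forall_lt_succ ht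
    have hnot : t 1 ∉ List.ofFn fun i : Fin n => t (i.1 + 1 + 1) := by
      rw [List.mem_ofFn]
      rintro ⟨i, hi⟩
      exact (hmono (i.1 + 1 + 1) (by omega) 1 (by omega)).ne' hi
    have hpath (y : S) (z : Fin n → S) (i : ℕ) (hi : i ≤ n) :
        pathOf x (n + 1) (Fin.cons y z) (i + 1) = pathOf y n z i := by
      rcases i with _ | i
      · simp [pathOf]
      · have h1 : i < n := by omega
        simp only [pathOf, Nat.zero_lt_succ, Nat.add_sub_cancel, true_and, h1,
          Nat.succ_lt_succ h1, dite_true]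
        exact Fin.cons_succ (α := fun _ => S) y z ⟨i, h1⟩
    have hGm : Measurable fun z : Fin (n + 1) → S => g z * ∏ i ∈ Finset.range (n + 1),
        p (t (i + 1) - t i) (pathOf x (n + 1) z (i + 1)) (pathOf x (n + 1) z i) :=
      hg.mul (measurable_prod_pathOf hp t x (n + 1))
    rw [List.ofFn_succ, lintegral_resampleLaw_cons hp _ _ _ _ _
      (f := fun w => g fun i => w (t (i.1 + 1)))
      (hg.comp (measurable_pi_lambda _ fun i => measurable_pi_apply _)),
      lintegral_pi_fin_succ hGm]
    refine lintegral_congr fun y => ?_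
    have hgy : Measurable fun z : Fin n → S => g (Fin.cons y z) :=
      hg.comp (measurable_pi_lambda _ fun i => by
        refine Fin.cases ?_ (fun i => ?_) i
        · simp
        · simpa using measurable_pi_apply i)
    have hinner := ih (t := fun i => t (i + 1)) (fun i hi => ht (i + 1) (by omega)) y
      (Function.update ω (t 1) y) hgy
    have hleft : ∫⁻ w, g (fun i => w (t (i.1 + 1))) ∂resampleLaw μ p
        (List.ofFn fun i : Fin n => t (i.1 + 1 + 1)) (t 1) y (Function.update ω (t 1) y) =
        ∫⁻ w, g (Fin.cons y fun i : Fin n => w (t (i.1 + 1 + 1))) ∂resampleLaw μ p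
        (List.ofFn fun i : Fin n => t (i.1 + 1 + 1)) (t 1) y (Function.update ω (t 1) y) := by
      refine lintegral_congr_ae ?_
      filter_upwards [ae_resampleLaw_eq (μ := μ) hp hnot (t 1) y (Function.update ω (t 1) y)]
        with w hw
      congr 1
      ext i
      refine Fin.cases ?_ (fun i => ?_) i
      · simpa using hw
      · simp
    simp only [Fin.val_succ, Fin.val_zero, Nat.zero_add] at hinner ⊢
    rw [hleft, hinner, ← lintegral_const_mul]
    · refine lintegral_congr fun z => ?_
      rw [Finset.prod_range_succ', hpath y z 0 (Nat.zero_le n)]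
      have h0 : pathOf x (n + 1) (Fin.cons y z : Fin (n + 1) → S) 0 = x := by simp [pathOf]
      have h1 : pathOf y n z 0 = y := by simp [pathOf]
      have h2 : ∀ i ∈ Finset.range n, p (t (i + 1 + 1) - t (i + 1))
          (pathOf x (n + 1) (Fin.cons y z) (i + 1 + 1)) (pathOf x (n + 1) (Fin.cons y z) (i + 1)) =
          p (t (i + 1 + 1) - t (i + 1)) (pathOf y n z (i + 1)) (pathOf y n z i) := fun i hi => by
        rw [hpath y z (i + 1) (Finset.mem_range.1 hi), hpath y z i (Finset.mem_range.1 hi).le]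
      rw [h0, h1, Finset.prod_congr rfl h2]
      ring
    · exact hgy.mul (measurable_prod_pathOf hp (fun i => t (i + 1)) y n)

end FiniteDimensionalLaws

section PathLaw

/-- The elements of `J` in `(0, T)`, in increasing order. -/
def interiorTimes (T : ℝ) (J : Finset ℝ) : List ℝ := (J.filter fun t => 0 < t ∧ t < T).sort

theorem mem_interiorTimes {T t : ℝ} {J : Finset ℝ} :
    t ∈ interiorTimes T J ↔ t ∈ J ∧ 0 < t ∧ t < T := by
  simp [interiorTimes]

theorem pairwise_interiorTimes {T : ℝ} (hT : 0 < T) (J : Finset ℝ) :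
    (0 :: (interiorTimes T J ++ [T])).Pairwise (· < ·) := by
  rw [List.pairwise_cons, List.pairwise_append]
  refine ⟨fun t ht => ?_, (Finset.sortedLT_sort _).pairwise, by simp, fun _ ht _ hu => ?_⟩
  · rcases List.mem_append.1 ht with h | h
    · exact (mem_interiorTimes.1 h).2.1
    · exact (List.mem_singleton.1 h) ▸ hT
  · exact (List.mem_singleton.1 hu) ▸ (mem_interiorTimes.1 ht).2.2

theorem interiorTimes_sublist (T : ℝ) {I J : Finset ℝ} (h : J ⊆ I) :
    (interiorTimes T J).Sublist (interiorTimes T I) :=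
  List.sublist_of_subperm_of_sortedLE
    (List.subperm_of_subset (Finset.sort_nodup _ _) fun _ ht =>
      mem_interiorTimes.2 ⟨h (mem_interiorTimes.1 ht).1, (mem_interiorTimes.1 ht).2⟩)
    (Finset.sortedLT_sort _).sortedLE (Finset.sortedLT_sort _).sortedLE

theorem interiorTimes_eq {T : ℝ} {l : List ℝ} (hl : (0 :: (l ++ [T])).Pairwise (· < ·)) :
    interiorTimes T ({0, T} ∪ l.toFinset) = l := by
  rw [List.pairwise_cons, List.pairwise_append] at hl
  have hset : ({0, T} ∪ l.toFinset).filter (fun t => 0 < t ∧ t < T) = l.toFinset := by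
    ext t
    simp only [Finset.mem_filter, Finset.mem_union, Finset.mem_insert, Finset.mem_singleton,
      List.mem_toFinset]
    constructor
    · rintro ⟨(rfl | rfl) | h, h0, h1⟩
      · exact absurd h0 (lt_irrefl _)
      · exact absurd h1 (lt_irrefl _)
      · exact h
    · exact fun h => ⟨Or.inr h, hl.1 t (List.mem_append_left _ h), hl.2.2.2 t h T (by simp)⟩
  rw [interiorTimes, hset]
  exact (List.toFinset_sort _ (hl.2.1.imp ne_of_lt)).2 (hl.2.1.imp le_of_lt)

variable {S : Type*} [MeasurableSpace S] {μ : Measure S} [SigmaFinite μ]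
  {p : ℝ → S → S → ℝ≥0∞} {T : ℝ}

theorem isProjectiveMeasureFamily_map_resampleLaw (hT : 0 < T)
    (hp : ∀ t, Measurable (Function.uncurry (p t)))
    (hCK : ∀ s t : ℝ, 0 < s → 0 < t → s + t ≤ T →
      ∀ x z : S, ∫⁻ y, p t z y * p s y x ∂μ = p (t + s) z x) (x : S) (ω : ℝ → S) :
    IsProjectiveMeasureFamily (α := fun _ : ℝ => S) fun J =>
      (resampleLaw μ p (interiorTimes T J ++ [T]) 0 x ω).map J.restrict := by
  intro I J hJI
  have hrJ : Measurable (J.restrict (π := fun _ => S)) := Finset.measurable_restrict J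
  rw [Measure.map_map (Finset.measurable_restrict₂ hJI) (Finset.measurable_restrict I),
    Finset.restrict₂_comp_restrict]
  ext A hA
  rw [Measure.map_apply hrJ hA, Measure.map_apply hrJ hA, ← lintegral_indicator_one (hrJ hA),
    ← lintegral_indicator_one (hrJ hA)]
  refine (lintegral_resampleLaw_sublist hp hCK (measurable_one.indicator (hrJ hA))
    (interiorTimes_sublist T hJI) le_rfl (pairwise_interiorTimes hT I)
    (fun t ht htJ w y => ?_) x ω).symm
  have hne : t ∉ J := fun h => htJ (mem_interiorTimes.2 ⟨h, (mem_interiorTimes.1 ht).2⟩)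
  have hres : J.restrict (Function.update w t y) = J.restrict w := by
    ext i
    have hi : (i : ℝ) ≠ t := fun h => hne (h ▸ i.2)
    exact Function.update_of_ne hi _ _
  change A.indicator 1 (J.restrict (Function.update w t y)) = A.indicator 1 (J.restrict w)
  rw [hres]

/-- A law on paths whose finite-dimensional marginals are given by the transition densities. -/
theorem exists_path_law [TopologicalSpace S] [PolishSpace S] [BorelSpace S] (hT : 0 < T)
    (hp : ∀ t, Measurable (Function.uncurry (p t))) (hsub : ∀ t x, ∫⁻ y, p t y x ∂μ ≤ 1)
    (hCK : ∀ s t : ℝ, 0 < s → 0 < t → s + t ≤ T →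
      ∀ x z : S, ∫⁻ y, p t z y * p s y x ∂μ = p (t + s) z x) (x : S) :
    ∃ ν : Measure (ℝ → S), ν Set.univ ≤ 1 ∧
      ∀ l : List ℝ, (0 :: (l ++ [T])).Pairwise (· < ·) → ∀ f : (ℝ → S) → ℝ≥0∞, Measurable f →
        DependsOn f {t | t = 0 ∨ t = T ∨ t ∈ l} →
        ∫⁻ w, f w ∂ν = ∫⁻ w, f w ∂resampleLaw μ p (l ++ [T]) 0 x fun _ => x := by
  classical
  have hfin (l : List ℝ) : IsFiniteMeasure (resampleLaw μ p l 0 x fun _ => x) :=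
    ⟨(resampleLaw_univ_le hp hsub l 0 x _).trans_lt ENNReal.one_lt_top⟩
  obtain ⟨ν, hν⟩ := exists_isProjectiveLimit
    (isProjectiveMeasureFamily_map_resampleLaw (μ := μ) hT hp hCK x fun _ => x)
  have key : ∀ l : List ℝ, (0 :: (l ++ [T])).Pairwise (· < ·) → ∀ f : (ℝ → S) → ℝ≥0∞,
      Measurable f → DependsOn f {t | t = 0 ∨ t = T ∨ t ∈ l} →
      ∫⁻ w, f w ∂ν = ∫⁻ w, f w ∂resampleLaw μ p (l ++ [T]) 0 x fun _ => x := by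
    intro l hl f hf hdep
    set J : Finset ℝ := {0, T} ∪ l.toFinset with hJ
    let e : (J → S) → ℝ → S := fun z t => if h : t ∈ J then z ⟨t, h⟩ else x
    have he : Measurable e := measurable_pi_lambda _ fun t => by
      by_cases h : t ∈ J
      · simpa [e, h] using measurable_pi_apply _
      · simp [e, h]
    have hfe (w : ℝ → S) : f w = f (e (J.restrict w)) := hdep fun t ht => by
      have : t ∈ J := by simpa [hJ, or_assoc] using ht
      simp [e, this]
    have hr : Measurable (J.restrict (π := fun _ => S)) := Finset.measurable_restrict J
    have h : ν.map J.restrict =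
        (resampleLaw μ p (interiorTimes T J ++ [T]) 0 x fun _ => x).map J.restrict := hν J
    rw [show interiorTimes T J = l from interiorTimes_eq hl] at h
    have hmap (κ : Measure (ℝ → S)) : ∫⁻ w, f w ∂κ = ∫⁻ z, f (e z) ∂κ.map J.restrict := by
      rw [lintegral_map (f := fun z => f (e z)) (hf.comp he) hr]
      exact lintegral_congr hfe
    rw [hmap, h, ← hmap]
  refine ⟨ν, ?_, key⟩
  rw [← lintegral_one, key [] (by simpa using hT) _ measurable_const fun _ _ _ => rfl,
    lintegral_one]
  exact resampleLaw_univ_le hp hsub _ _ _ _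

end PathLaw

section Increments

variable {S : Type*} [MetricSpace S] [SecondCountableTopology S] [MeasurableSpace S]
  [BorelSpace S] {μ : Measure S} [SigmaFinite μ] {p : ℝ → S → S → ℝ≥0∞} {T a : ℝ} {c : ℝ≥0∞}

theorem measurable_dist_rpow_eval (a s t : ℝ) :
    Measurable fun w : ℝ → S => ENNReal.ofReal (dist (w t) (w s) ^ a) :=
  (((measurable_pi_apply t).dist (measurable_pi_apply s)).pow_const a).ennreal_ofReal

theorem lintegral_dist_rpow_resampleLaw_le (hp : ∀ t, Measurable (Function.uncurry (p t)))
    (hsub : ∀ t x, ∫⁻ y, p t y x ∂μ ≤ 1) {s t : ℝ}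
    (hc : ∀ x, ∫⁻ y, ENNReal.ofReal (dist y x ^ a) * p (t - s) y x ∂μ ≤ c)
    {l : List ℝ} (hs : s ∉ t :: l) (ht : t ∉ l) (ω : ℝ → S) :
    ∫⁻ w, ENNReal.ofReal (dist (w t) (w s) ^ a) ∂resampleLaw μ p (t :: l) s (ω s) ω ≤ c := by
  rw [List.mem_cons, not_or] at hs
  rw [lintegral_resampleLaw_cons hp t l s _ ω (measurable_dist_rpow_eval a s t)]
  refine (lintegral_mono fun y => ?_).trans (hc (ω s))
  rw [mul_comm (ENNReal.ofReal _)]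
  gcongr
  calc ∫⁻ w, ENNReal.ofReal (dist (w t) (w s) ^ a)
        ∂resampleLaw μ p l t y (Function.update ω t y)
      = ∫⁻ _, ENNReal.ofReal (dist y (ω s) ^ a)
        ∂resampleLaw μ p l t y (Function.update ω t y) := by
        refine lintegral_congr_ae ?_
        filter_upwards [ae_resampleLaw_eq (μ := μ) hp ht t y (Function.update ω t y),
          ae_resampleLaw_eq (μ := μ) hp hs.2 t y (Function.update ω t y)] with w h1 h2
        rw [h1, h2, Function.update_self, Function.update_of_ne hs.1]
    _ ≤ ENNReal.ofReal (dist y (ω s) ^ a) := by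
        rw [lintegral_const]
        exact mul_le_of_le_one_right' (resampleLaw_univ_le hp hsub _ _ _ _)

theorem lintegral_dist_rpow_le {ν : Measure (ℝ → S)} {x : S}
    (hν : ∀ l : List ℝ, (0 :: (l ++ [T])).Pairwise (· < ·) → ∀ f : (ℝ → S) → ℝ≥0∞, Measurable f →
        DependsOn f {t | t = 0 ∨ t = T ∨ t ∈ l} →
        ∫⁻ w, f w ∂ν = ∫⁻ w, f w ∂resampleLaw μ p (l ++ [T]) 0 x fun _ => x)
    (hp : ∀ t, Measurable (Function.uncurry (p t))) (hsub : ∀ t x, ∫⁻ y, p t y x ∂μ ≤ 1)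
    {s t : ℝ} (hs : 0 ≤ s) (hst : s < t) (htT : t ≤ T)
    (hc : ∀ x, ∫⁻ y, ENNReal.ofReal (dist y x ^ a) * p (t - s) y x ∂μ ≤ c) :
    ∫⁻ w, ENNReal.ofReal (dist (w t) (w s) ^ a) ∂ν ≤ c := by
  obtain ⟨m, l, hml, hpair, hm⟩ : ∃ m l : List ℝ, m ++ [T] = t :: l ∧
      (t :: l).Pairwise (· < ·) ∧ (t = T ∨ t ∈ m) := by
    rcases htT.eq_or_lt with rfl | h
    · exact ⟨[], [], rfl, by simp, Or.inl rfl⟩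
    · exact ⟨[t], [T], rfl, by simpa using h, Or.inr (by simp)⟩
  have hpair' : (s :: t :: l).Pairwise (· < ·) := List.pairwise_cons.2 ⟨fun u hu => by
    rcases List.mem_cons.1 hu with rfl | hu
    · exact hst
    · exact hst.trans ((List.pairwise_cons.1 hpair).1 u hu), hpair⟩
  have hs' : s ∉ t :: l := fun h => lt_irrefl _ ((List.pairwise_cons.1 hpair').1 s h)
  have ht' : t ∉ l := fun h => lt_irrefl _ ((List.pairwise_cons.1 hpair).1 t h)
  have hdep {A : Set ℝ} (h1 : s ∈ A) (h2 : t ∈ A) :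
      DependsOn (fun w : ℝ → S => ENNReal.ofReal (dist (w t) (w s) ^ a)) A := fun w w' h => by
    simp only [h s h1, h t h2]
  have hbound := lintegral_dist_rpow_resampleLaw_le hp hsub hc hs' ht'
  rcases hs.eq_or_lt with rfl | hs0
  · rw [hν m (hml ▸ hpair') _ (measurable_dist_rpow_eval a 0 t)
      (hdep (Or.inl rfl) (Or.inr hm)), hml]
    exact hbound _
  · have hpair0 : (0 :: s :: t :: l).Pairwise (· < ·) := List.pairwise_cons.2 ⟨fun u hu => by
      rcases List.mem_cons.1 hu with rfl | hu
      · exact hs0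
      · exact hs0.trans ((List.pairwise_cons.1 hpair').1 u hu), hpair'⟩
    rw [hν (s :: m) (by rwa [List.cons_append, hml]) _ (measurable_dist_rpow_eval a s t)
      (hdep (by simp) (hm.elim (by simp_all) (by simp_all))), List.cons_append, hml,
      lintegral_resampleLaw_cons hp _ _ _ _ _ (measurable_dist_rpow_eval a s t)]
    calc _ ≤ ∫⁻ y, p (s - 0) y x * c ∂μ := by
          refine lintegral_mono fun y => ?_
          gcongr
          simpa using hbound (Function.update (fun _ => x) s y)
      _ ≤ c := by
          rw [lintegral_mul_const _ (hp _).of_uncurry_right]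
          exact mul_le_of_le_one_left' (hsub _ _)

end Increments

section KolmogorovChentsov

/-- The largest multiple of `2⁻ⁿ` below `x`. -/
def dyadicFloor (n : ℕ) (x : ℝ) : ℝ := (⌊2 ^ n * x⌋₊ : ℝ) / 2 ^ n

theorem dyadicFloor_zero (n : ℕ) : dyadicFloor n 0 = 0 := by simp [dyadicFloor]

theorem dyadicFloor_nonneg (n : ℕ) (x : ℝ) : 0 ≤ dyadicFloor n x := by
  unfold dyadicFloor; positivity

theorem dyadicFloor_le {x : ℝ} (hx : 0 ≤ x) (n : ℕ) : dyadicFloor n x ≤ x := by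
  rw [dyadicFloor, div_le_iff₀ (by positivity), mul_comm]
  exact Nat.floor_le (by positivity)

theorem dyadicFloor_mono (n : ℕ) : Monotone (dyadicFloor n) := fun x y h => by
  unfold dyadicFloor
  have : ⌊2 ^ n * x⌋₊ ≤ ⌊2 ^ n * y⌋₊ := Nat.floor_mono (by gcongr)
  gcongr

theorem sub_dyadicFloor_le (x : ℝ) (n : ℕ) : x - dyadicFloor n x ≤ (1 / 2) ^ n := by
  have h := (Nat.lt_floor_add_one (2 ^ n * x)).le
  have h2 : (0 : ℝ) < 2 ^ n := by positivity
  have h3 : x ≤ ((⌊2 ^ n * x⌋₊ : ℝ) + 1) / 2 ^ n := by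
    rw [le_div_iff₀ h2]; linarith
  rw [add_div] at h3
  rw [dyadicFloor, one_div_pow]
  linarith

variable {S : Type*} [MetricSpace S]

/-- All increments of `f` over the dyadic intervals `[k 2⁻ⁿ, (k + 1) 2⁻ⁿ]` in `[0, 1]` are at
most `L 2^(-θ n)`. -/
def DyadicHolder (f : ℝ → S) (θ L : ℝ) : Prop :=
  ∀ n k : ℕ, k < 2 ^ n →
    dist (f (((k : ℝ) + 1) / 2 ^ n)) (f ((k : ℝ) / 2 ^ n)) ≤ L * ((2 : ℝ) ^ (-θ)) ^ n

variable {f : ℝ → S} {θ L : ℝ}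

theorem DyadicHolder.dist_dyadicFloor_le (h : DyadicHolder f θ L) (hL : 0 ≤ L) {n : ℕ} {x y : ℝ}
    (hx : 0 ≤ x) (hxy : x ≤ y) (hy : y ≤ 1) (hn : y - x ≤ (1 / 2) ^ n) :
    dist (f (dyadicFloor n y)) (f (dyadicFloor n x)) ≤ L * ((2 : ℝ) ^ (-θ)) ^ n := by
  have h2 : (0 : ℝ) < 2 ^ n := by positivity
  have hle : ⌊2 ^ n * x⌋₊ ≤ ⌊2 ^ n * y⌋₊ := Nat.floor_mono (by gcongr)
  have hle' : ⌊2 ^ n * y⌋₊ ≤ ⌊2 ^ n * x⌋₊ + 1 := by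
    rw [← Nat.floor_add_one (by positivity)]
    refine Nat.floor_mono ?_
    rw [one_div_pow, le_div_iff₀ h2] at hn
    linarith
  rcases Nat.le_add_one_iff.1 hle' with h1 | h1
  · rw [dyadicFloor, dyadicFloor, le_antisymm h1 hle, dist_self]
    positivity
  · rw [dyadicFloor, dyadicFloor, h1]
    push_cast
    refine h n _ ?_
    have h3 : ⌊2 ^ n * y⌋₊ ≤ 2 ^ n := Nat.floor_le_of_le (by push_cast; nlinarith)
    omega

theorem DyadicHolder.dist_dyadicFloor_succ_le (h : DyadicHolder f θ L) (hL : 0 ≤ L) {x : ℝ}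
    (hx : 0 ≤ x) (hx1 : x ≤ 1) (n : ℕ) :
    dist (f (dyadicFloor n x)) (f (dyadicFloor (n + 1) x)) ≤
      L * ((2 : ℝ) ^ (-θ)) ^ (n + 1) := by
  have hfix : dyadicFloor (n + 1) (dyadicFloor n x) = dyadicFloor n x := by
    have : 2 ^ (n + 1) * dyadicFloor n x = ((2 * ⌊2 ^ n * x⌋₊ : ℕ) : ℝ) := by
      unfold dyadicFloor; push_cast; field_simp; ring
    conv_lhs => rw [dyadicFloor]
    rw [this, Nat.floor_natCast, ← this]
    field_simp
  have hle : dyadicFloor n x ≤ dyadicFloor (n + 1) x := by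
    rw [← hfix]
    exact dyadicFloor_mono (n + 1) (dyadicFloor_le hx n)
  have hclose : dyadicFloor (n + 1) x - dyadicFloor n x ≤ (1 / 2) ^ (n + 1) := by
    have h2 : (0 : ℝ) < 2 ^ n := by positivity
    have : ⌊2 ^ (n + 1) * x⌋₊ ≤ 2 * ⌊2 ^ n * x⌋₊ + 1 := by
      refine Nat.lt_succ_iff.1 ((Nat.floor_lt (by positivity)).2 ?_)
      have := Nat.lt_floor_add_one (2 ^ n * x)
      push_cast
      rw [pow_succ]
      linarith
    have h' : (⌊2 ^ (n + 1) * x⌋₊ : ℝ) ≤ 2 * ⌊2 ^ n * x⌋₊ + 1 := by exact_mod_cast this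
    rw [dyadicFloor, dyadicFloor, one_div_pow]
    generalize (⌊2 ^ (n + 1) * x⌋₊ : ℝ) = k at h' ⊢
    generalize (⌊2 ^ n * x⌋₊ : ℝ) = m at h' ⊢
    rw [sub_le_iff_le_add, div_le_iff₀ (by positivity), pow_succ]
    field_simp
    linarith
  have hfix' : dyadicFloor (n + 1) (dyadicFloor (n + 1) x) = dyadicFloor (n + 1) x := by
    conv_lhs => rw [dyadicFloor]
    have : 2 ^ (n + 1) * dyadicFloor (n + 1) x = (⌊2 ^ (n + 1) * x⌋₊ : ℝ) := by
      unfold dyadicFloor; field_simp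
    rw [this, Nat.floor_natCast, dyadicFloor]
  have := h.dist_dyadicFloor_le hL (dyadicFloor_nonneg n x) hle
    ((dyadicFloor_le hx _).trans hx1) hclose
  rwa [hfix, hfix', dist_comm] at this

theorem two_rpow_neg_lt_one (hθ : 0 < θ) : (2 : ℝ) ^ (-θ) < 1 :=
  Real.rpow_lt_one_of_one_lt_of_neg (by norm_num) (by linarith)

theorem DyadicHolder.dist_succ_le_geometric (h : DyadicHolder f θ L) (hL : 0 ≤ L) (hθ : 0 < θ)
    {x : ℝ} (hx : 0 ≤ x) (hx1 : x ≤ 1) (n : ℕ) :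
    dist (f (dyadicFloor n x)) (f (dyadicFloor (n + 1) x)) ≤ L * ((2 : ℝ) ^ (-θ)) ^ n := by
  refine (h.dist_dyadicFloor_succ_le hL hx hx1 n).trans ?_
  gcongr L * ?_
  exact pow_le_pow_of_le_one (by positivity) (two_rpow_neg_lt_one hθ).le (Nat.le_succ n)

theorem DyadicHolder.exists_tendsto [CompleteSpace S] (h : DyadicHolder f θ L) (hL : 0 ≤ L)
    (hθ : 0 < θ) {x : ℝ} (hx : 0 ≤ x) (hx1 : x ≤ 1) :
    ∃ z, Tendsto (fun n => f (dyadicFloor n x)) atTop (𝓝 z) :=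
  cauchySeq_tendsto_of_complete (cauchySeq_of_le_geometric _ _ (two_rpow_neg_lt_one hθ)
    (h.dist_succ_le_geometric hL hθ hx hx1))

theorem DyadicHolder.dist_le_of_tendsto (h : DyadicHolder f θ L) (hL : 0 ≤ L) (hθ : 0 < θ)
    {g : ℝ → S}
    (hg : ∀ x, 0 ≤ x → x ≤ 1 → Tendsto (fun n => f (dyadicFloor n x)) atTop (𝓝 (g x)))
    {x y : ℝ} (hx : 0 ≤ x) (hxy : x ≤ y) (hy : y ≤ 1) :
    dist (g x) (g y) ≤
      (2 * (L / (1 - (2 : ℝ) ^ (-θ))) + L) * (2 : ℝ) ^ θ * (y - x) ^ θ := by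
  have hr := two_rpow_neg_lt_one hθ
  have hr' : (0 : ℝ) < 1 - (2 : ℝ) ^ (-θ) := by linarith
  rcases hxy.eq_or_lt with rfl | hlt
  · rw [dist_self]
    have : (0 : ℝ) ≤ x - x := by simp
    positivity
  obtain ⟨n, hn, hn'⟩ := exists_nat_pow_near_of_lt_one (sub_pos.2 hlt) (by linarith : y - x ≤ 1)
    (by norm_num : (0 : ℝ) < 1 / 2) (by norm_num)
  have hpow : ((2 : ℝ) ^ (-θ)) ^ n ≤ (2 : ℝ) ^ θ * (y - x) ^ θ := by
    rw [← Real.mul_rpow (by norm_num) (sub_pos.2 hlt).le, Real.rpow_neg (by norm_num),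
      ← Real.inv_rpow (by norm_num), ← Real.rpow_natCast, ← Real.rpow_mul (by norm_num), mul_comm θ,
      Real.rpow_mul (by norm_num), Real.rpow_natCast]
    refine Real.rpow_le_rpow (by positivity) ?_ hθ.le
    rw [pow_succ] at hn
    norm_num at hn ⊢
    linarith
  have h1 := dist_le_of_le_geometric_of_tendsto _ _ hr
    (h.dist_succ_le_geometric hL hθ hx (hxy.trans hy)) (hg x hx (hxy.trans hy)) n
  have h2 := dist_le_of_le_geometric_of_tendsto _ _ hr
    (h.dist_succ_le_geometric hL hθ (hx.trans hxy) hy) (hg y (hx.trans hxy) hy) n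
  have h3 := h.dist_dyadicFloor_le hL hx hxy hy hn'
  have h4 : dist (g x) (g y) ≤
      (2 * (L / (1 - (2 : ℝ) ^ (-θ))) + L) * ((2 : ℝ) ^ (-θ)) ^ n := by
    have := dist_triangle4 (g x) (f (dyadicFloor n x)) (f (dyadicFloor n y)) (g y)
    rw [dist_comm (g x) (f _), dist_comm (f (dyadicFloor n x)) (f (dyadicFloor n y))] at this
    refine (this.trans (add_le_add (add_le_add h1 h3) h2)).trans (le_of_eq ?_)
    ring
  refine h4.trans ?_
  rw [mul_assoc]
  gcongr

section Modification

variable {S : Type*} [MetricSpace S] [MeasurableSpace S]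
  {Ω : Type*} [MeasurableSpace Ω] {P : Measure Ω} {X : ℝ → Ω → S} {a b C ε θ : ℝ}

variable [BorelSpace S] [SecondCountableTopology S]

/-- The union-bound step in the Kolmogorov–Chentsov theorem. -/
theorem ae_exists_dyadicHolder (hX : ∀ u, Measurable (X u)) (ha : 0 < a) (hC : 0 ≤ C)
    (hε : 0 < ε)
    (hmom : ∀ u v : ℝ, 0 ≤ u → u < v → v ≤ 1 → v - u < ε →
      ∫⁻ ω, ENNReal.ofReal (dist (X v ω) (X u ω) ^ a) ∂P ≤ ENNReal.ofReal (C * (v - u) ^ (1 + b)))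
    (hθ : θ < b / a) :
    ∀ᵐ ω ∂P, ∃ L, 0 ≤ L ∧ DyadicHolder (fun u => X u ω) θ L := by
  obtain ⟨N, hN⟩ := exists_pow_lt_of_lt_one hε (by norm_num : (1 / 2 : ℝ) < 1)
  set r : ℝ := (2 : ℝ) ^ (-θ) with hr
  have hr0 : 0 < r := by positivity
  let D : ℕ → ℕ → Ω → ℝ := fun n k ω =>
    dist (X (((k : ℝ) + 1) / 2 ^ n) ω) (X ((k : ℝ) / 2 ^ n) ω) / r ^ n
  have hD0 (n k : ℕ) (ω : Ω) : 0 ≤ D n k ω := by positivity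
  have hDm (n k : ℕ) : Measurable fun ω => ENNReal.ofReal (D n k ω ^ a) :=
    ((((hX _).dist (hX _)).div_const _).pow_const a).ennreal_ofReal
  set q : ℝ := (2 : ℝ) ^ (θ * a - b) with hq
  have hq1 : q < 1 := by
    refine Real.rpow_lt_one_of_one_lt_of_neg (by norm_num) ?_
    rw [lt_div_iff₀ ha] at hθ
    linarith
  have hDint (n k : ℕ) (hn : N ≤ n) (hk : k < 2 ^ n) :
      ∫⁻ ω, ENNReal.ofReal (D n k ω ^ a) ∂P ≤ ENNReal.ofReal (C * (q / 2) ^ n) := by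
    have hsub : ((k : ℝ) + 1) / 2 ^ n - (k : ℝ) / 2 ^ n = (1 / 2) ^ n := by
      rw [← sub_div, one_div_pow]; simp
    have hk' : ((k : ℝ) + 1) / 2 ^ n ≤ 1 := by
      rw [div_le_one (by positivity)]
      exact_mod_cast hk
    have hlt : (1 / 2 : ℝ) ^ n < ε :=
      (pow_le_pow_of_le_one (by norm_num) (by norm_num) hn).trans_lt hN
    have h := hmom ((k : ℝ) / 2 ^ n) (((k : ℝ) + 1) / 2 ^ n) (by positivity)
      (by have : (0 : ℝ) < (1 / 2) ^ n := by positivity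
          linarith) hk' (hsub ▸ hlt)
    rw [hsub] at h
    have hDa (ω : Ω) : ENNReal.ofReal (D n k ω ^ a) = ENNReal.ofReal
        (dist (X (((k : ℝ) + 1) / 2 ^ n) ω) (X ((k : ℝ) / 2 ^ n) ω) ^ a) *
        ENNReal.ofReal (((r ^ n) ^ a)⁻¹) := by
      rw [← ENNReal.ofReal_mul (by positivity), Real.div_rpow (by positivity) (by positivity),
        div_eq_mul_inv]
    simp_rw [hDa]
    rw [lintegral_mul_const _ (((hX _).dist (hX _)).pow_const a).ennreal_ofReal]
    refine (mul_le_mul_left h _).trans (le_of_eq ?_)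
    rw [← ENNReal.ofReal_mul (by positivity), mul_assoc]
    congr 2
    have e1 : ((1 / 2 : ℝ) ^ n) ^ (1 + b) = ((2 : ℝ) ^ (-(1 + b))) ^ n := by
      rw [← Real.rpow_pow_comm (by norm_num), one_div, Real.inv_rpow (by norm_num),
        Real.rpow_neg (by norm_num)]
    have e2 : ((r ^ n) ^ a)⁻¹ = ((2 : ℝ) ^ (θ * a)) ^ n := by
      rw [← Real.rpow_pow_comm hr0.le, hr, ← Real.rpow_mul (by norm_num), ← inv_pow,
        ← Real.rpow_neg (by norm_num)]
      ring_nf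
    have e3 : q / 2 = (2 : ℝ) ^ (-(1 + b)) * (2 : ℝ) ^ (θ * a) := by
      rw [hq, ← Real.rpow_add (by norm_num), ← Real.rpow_sub_one (by norm_num)]
      ring_nf
    rw [e1, e2, e3, mul_pow]
  let F : Ω → ℝ≥0∞ := fun ω => ∑' m : ℕ, ∑ k ∈ Finset.range (2 ^ (N + m)),
    ENNReal.ofReal (D (N + m) k ω ^ a)
  have hFsm (m : ℕ) : Measurable fun ω => ∑ k ∈ Finset.range (2 ^ (N + m)),
      ENNReal.ofReal (D (N + m) k ω ^ a) := Finset.measurable_fun_sum _ fun k _ => hDm _ k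
  have hFm : Measurable F := Measurable.tsum hFsm
  have hFint : ∫⁻ ω, F ω ∂P ≠ ∞ := by
    have hle : ∫⁻ ω, F ω ∂P ≤ ∑' m : ℕ, ENNReal.ofReal (C * q ^ N * q ^ m) := by
      rw [lintegral_tsum fun m => (hFsm m).aemeasurable]
      refine ENNReal.tsum_le_tsum fun m => ?_
      rw [lintegral_finsetSum _ fun k _ => hDm _ k]
      refine (Finset.sum_le_sum fun k hk => hDint (N + m) k (by omega)
        (Finset.mem_range.1 hk)).trans (le_of_eq ?_)
      rw [Finset.sum_const, Finset.card_range, nsmul_eq_mul, ← ENNReal.ofReal_natCast,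
        ← ENNReal.ofReal_mul (by positivity)]
      congr 1
      push_cast
      rw [div_pow, mul_assoc C, ← pow_add]
      field_simp
    exact (hle.trans_lt ((summable_geometric_of_lt_one (by positivity) hq1).mul_left
      _).tsum_ofReal_lt_top).ne
  filter_upwards [ae_lt_top hFm hFint] with ω hω
  have hsum (n k : ℕ) (hk : k < 2 ^ n) : 0 ≤ ∑ k ∈ Finset.range (2 ^ n), D n k ω ∧
      D n k ω ≤ ∑ k ∈ Finset.range (2 ^ n), D n k ω :=
    ⟨Finset.sum_nonneg fun k _ => hD0 n k ω,
      Finset.single_le_sum (fun k _ => hD0 n k ω) (Finset.mem_range.2 hk)⟩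
  have hsum0 : 0 ≤ ∑ n ∈ Finset.range N, ∑ k ∈ Finset.range (2 ^ n), D n k ω :=
    Finset.sum_nonneg fun n _ => Finset.sum_nonneg fun k _ => hD0 n k ω
  refine ⟨(F ω).toReal ^ a⁻¹ + ∑ n ∈ Finset.range N, ∑ k ∈ Finset.range (2 ^ n), D n k ω,
    by positivity, fun n k hk => ?_⟩
  rw [← div_le_iff₀ (by positivity)]
  change D n k ω ≤ _
  rcases lt_or_ge n N with hn | hn
  · refine ((hsum n k hk).2.trans ?_).trans (le_add_of_nonneg_left (by positivity))
    exact Finset.single_le_sum (f := fun n => ∑ k ∈ Finset.range (2 ^ n), D n k ω)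
      (fun n _ => Finset.sum_nonneg fun k _ => hD0 n k ω) (Finset.mem_range.2 hn)
  · refine le_trans ?_ (le_add_of_nonneg_right hsum0)
    rw [Real.le_rpow_inv_iff_of_pos (hD0 n k ω) ENNReal.toReal_nonneg ha,
      ← ENNReal.ofReal_le_iff_le_toReal hω.ne]
    obtain ⟨m, rfl⟩ := Nat.exists_eq_add_of_le hn
    exact (Finset.single_le_sum (f := fun k => ENNReal.ofReal (D (N + m) k ω ^ a))
      (fun _ _ => zero_le) (Finset.mem_range.2 hk)).trans
      (ENNReal.le_tsum (f := fun m => ∑ k ∈ Finset.range (2 ^ (N + m)),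
        ENNReal.ofReal (D (N + m) k ω ^ a)) m)

/-- The values of a process with small increments at time `u` agree almost everywhere with any
almost everywhere limit along the dyadic approximations of `u`. -/
theorem ae_eq_of_tendsto_dyadicFloor (hX : ∀ u, Measurable (X u)) (ha : 0 < a) (hb : 0 < b)
    (hε : 0 < ε)
    (hmom : ∀ u v : ℝ, 0 ≤ u → u < v → v ≤ 1 → v - u < ε →
      ∫⁻ ω, ENNReal.ofReal (dist (X v ω) (X u ω) ^ a) ∂P ≤ ENNReal.ofReal (C * (v - u) ^ (1 + b)))
    {u : ℝ} (hu : 0 ≤ u) (hu1 : u ≤ 1) {Z : Ω → S}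
    (hZ : ∀ᵐ ω ∂P, Tendsto (fun n => X (dyadicFloor n u) ω) atTop (𝓝 (Z ω))) :
    Z =ᵐ[P] X u := by
  let g : ℕ → Ω → ℝ≥0∞ := fun n ω =>
    ENNReal.ofReal (dist (X u ω) (X (dyadicFloor n u) ω) ^ a)
  have hgm (n : ℕ) : Measurable (g n) := (((hX _).dist (hX _)).pow_const a).ennreal_ofReal
  have hsub : Tendsto (fun n => u - dyadicFloor n u) atTop (𝓝 0) :=
    squeeze_zero (fun n => sub_nonneg.2 (dyadicFloor_le hu n)) (sub_dyadicFloor_le u)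
      (tendsto_pow_atTop_nhds_zero_of_lt_one (by norm_num) (by norm_num))
  have hgint : Tendsto (fun n => ∫⁻ ω, g n ω ∂P) atTop (𝓝 0) := by
    have hlim : Tendsto (fun n => ENNReal.ofReal (C * (u - dyadicFloor n u) ^ (1 + b))) atTop
        (𝓝 0) := by
      have := ENNReal.tendsto_ofReal
        ((hsub.rpow_const (p := 1 + b) (Or.inr (by linarith))).const_mul C)
      rwa [Real.zero_rpow (by linarith), mul_zero, ENNReal.ofReal_zero] at this
    refine tendsto_of_tendsto_of_tendsto_of_le_of_le' tendsto_const_nhds hlim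
      (Eventually.of_forall fun _ => zero_le) ?_
    filter_upwards [hsub.eventually (gt_mem_nhds hε)] with n hn
    rcases (dyadicFloor_le hu n).eq_or_lt with h | h
    · simp [g, h, Real.zero_rpow ha.ne']
    · exact hmom _ _ (dyadicFloor_nonneg n u) h hu1 hn
  have hliminf : ∫⁻ ω, liminf (fun n => g n ω) atTop ∂P = 0 :=
    le_antisymm ((lintegral_liminf_le hgm).trans hgint.liminf_eq.le) zero_le
  rw [lintegral_eq_zero_iff (.liminf hgm)] at hliminf
  filter_upwards [hliminf, hZ] with ω h0 hω
  have hg : Tendsto (fun n => g n ω) atTop (𝓝 (ENNReal.ofReal (dist (X u ω) (Z ω) ^ a))) :=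
    ENNReal.tendsto_ofReal ((tendsto_const_nhds.dist hω).rpow_const (Or.inr ha.le))
  have h1 : ENNReal.ofReal (dist (X u ω) (Z ω) ^ a) = 0 := hg.liminf_eq.symm.trans h0
  rw [ENNReal.ofReal_eq_zero] at h1
  by_contra hne
  exact absurd h1 (not_le.2 (Real.rpow_pos_of_pos (dist_pos.2 (Ne.symm hne)) a))

/-- The **Kolmogorov–Chentsov theorem** on `[0, 1]`, with an everywhere Hölder continuous
modification that starts at a prescribed point. -/
theorem exists_holder_modification [CompleteSpace S] (hX : ∀ u, Measurable (X u)) (ha : 0 < a)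
    (hb : 0 < b) (hC : 0 ≤ C) (hε : 0 < ε)
    (hmom : ∀ u v : ℝ, 0 ≤ u → u < v → v ≤ 1 → v - u < ε →
      ∫⁻ ω, ENNReal.ofReal (dist (X v ω) (X u ω) ^ a) ∂P ≤ ENNReal.ofReal (C * (v - u) ^ (1 + b)))
    {x₀ : S} (hX0 : ∀ᵐ ω ∂P, X 0 ω = x₀) :
    ∃ Y : ℝ → Ω → S, (∀ u ∈ Set.Icc (0 : ℝ) 1, Measurable (Y u)) ∧ (∀ ω, Y 0 ω = x₀) ∧
      (∀ u ∈ Set.Icc (0 : ℝ) 1, Y u =ᵐ[P] X u) ∧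
      ∀ ω θ, 0 < θ → θ < b / a → ∃ K, 0 ≤ K ∧ ∀ u ∈ Set.Icc (0 : ℝ) 1, ∀ v ∈ Set.Icc (0 : ℝ) 1,
        dist (Y u ω) (Y v ω) ≤ K * |u - v| ^ θ := by
  classical
  have hgood : ∀ᵐ ω ∂P, X 0 ω = x₀ ∧ ∀ q : ℚ, (q : ℝ) < b / a →
      ∃ L, 0 ≤ L ∧ DyadicHolder (fun u => X u ω) q L :=
    hX0.and (ae_all_iff.2 fun q => by
      by_cases hq : (q : ℝ) < b / a
      · simpa [hq] using ae_exists_dyadicHolder hX ha hC hε hmom hq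
      · simp [hq])
  obtain ⟨G, hG, hGm, hGsub⟩ := hgood.exists_measurable_mem
  have hrat {θ : ℝ} (hθ : 0 < θ) (hθ' : θ < b / a) (ω : Ω) (hω : ω ∈ G) :
      ∃ q : ℝ, θ < q ∧ ∃ L, 0 ≤ L ∧ DyadicHolder (fun u => X u ω) q L := by
    obtain ⟨q, hq, hq'⟩ := exists_rat_btwn hθ'
    exact ⟨q, hq, (hGsub ω hω).2 q hq'⟩
  have hlim (ω : Ω) (hω : ω ∈ G) (u : ℝ) (hu : 0 ≤ u) (hu1 : u ≤ 1) :
      ∃ z, Tendsto (fun n => X (dyadicFloor n u) ω) atTop (𝓝 z) := by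
    have : 0 < b / a := by positivity
    obtain ⟨q, hq, L, hL, h⟩ := hrat (half_pos this) (half_lt_self this) ω hω
    exact h.exists_tendsto hL (by linarith) hu hu1
  let Y : ℝ → Ω → S := fun u ω =>
    if h : ω ∈ G ∧ 0 ≤ u ∧ u ≤ 1 then (hlim ω h.1 u h.2.1 h.2.2).choose else x₀
  have hYlim (ω : Ω) (hω : ω ∈ G) (u : ℝ) (hu : 0 ≤ u) (hu1 : u ≤ 1) :
      Tendsto (fun n => X (dyadicFloor n u) ω) atTop (𝓝 (Y u ω)) := by
    simp only [Y, hω, hu, hu1, and_self, dite_true]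
    exact (hlim ω hω u hu hu1).choose_spec
  have hYnot (ω : Ω) (hω : ω ∉ G) (u : ℝ) : Y u ω = x₀ := by simp [Y, hω]
  refine ⟨Y, fun u hu => ?_, fun ω => ?_, fun u hu => ?_, fun ω θ hθ hθ' => ?_⟩
  · refine measurable_of_tendsto_metrizable
      (f := fun n ω => if ω ∈ G then X (dyadicFloor n u) ω else x₀)
      (fun n => (hX _).ite hGm measurable_const) (tendsto_pi_nhds.2 fun ω => ?_)
    by_cases hω : ω ∈ G
    · simpa [hω] using hYlim ω hω u hu.1 hu.2
    · simp [hω, hYnot]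
  · by_cases hω : ω ∈ G
    · have h := hYlim ω hω 0 le_rfl zero_le_one
      simp only [dyadicFloor_zero, (hGsub ω hω).1] at h
      exact tendsto_nhds_unique h tendsto_const_nhds |>.symm ▸ rfl
    · exact hYnot ω hω 0
  · refine ae_eq_of_tendsto_dyadicFloor hX ha hb hε hmom hu.1 hu.2 ?_
    filter_upwards [hG] with ω hω using hYlim ω hω u hu.1 hu.2
  · by_cases hω : ω ∈ G
    · obtain ⟨q, hq, L, hL, h⟩ := hrat hθ hθ' ω hω
      have hq0 : 0 < q := hθ.trans hq
      have hden : 0 < 1 - (2 : ℝ) ^ (-q) := by linarith [two_rpow_neg_lt_one hq0]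
      have key {u v : ℝ} (hu : 0 ≤ u) (huv : u ≤ v) (hv : v ≤ 1) : dist (Y u ω) (Y v ω) ≤
          (2 * (L / (1 - (2 : ℝ) ^ (-q))) + L) * (2 : ℝ) ^ q * (v - u) ^ θ := by
        refine (h.dist_le_of_tendsto hL hq0 (hYlim ω hω) hu huv hv).trans ?_
        gcongr _ * ?_
        rcases huv.eq_or_lt with rfl | hlt
        · simp [Real.zero_rpow hθ.ne', Real.zero_rpow hq0.ne']
        · exact Real.rpow_le_rpow_of_exponent_ge (by linarith) (by linarith) hq.le
      refine ⟨(2 * (L / (1 - (2 : ℝ) ^ (-q))) + L) * (2 : ℝ) ^ q, by positivity,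
        fun u hu v hv => ?_⟩
      rcases le_total u v with huv | huv
      · rw [abs_sub_comm, abs_of_nonneg (sub_nonneg.2 huv)]
        exact key hu.1 huv hv.2
      · rw [dist_comm, abs_of_nonneg (sub_nonneg.2 huv)]
        exact key hv.1 huv hu.2
    · exact ⟨0, le_rfl, fun u _ v _ => by simp [hYnot ω hω]⟩

end Modification

end KolmogorovChentsov

/-- Theorem 2.4 (existence of a diffusion process with prescribed starting point,
finite-dimensional distributions given by a substochastic transition function, and
Hölder continuous paths). -/
theorem existence_diffusion_process
    {S : Type} [MetricSpace S] [CompleteSpace S] [TopologicalSpace.SeparableSpace S]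
    [MeasurableSpace S] [BorelSpace S]
    (μ : Measure S) [SigmaFinite μ]
    (T : ℝ) (hT : 0 < T)
    (p : ℝ → S → S → ℝ≥0∞)
    -- `p` is a substochastic transition function on `S`:
    (hpMeas : ∀ t : ℝ, 0 < t → t ≤ T → Measurable (Function.uncurry (p t)))
    (hpSub : ∀ t : ℝ, 0 < t → t ≤ T → ∀ x : S, ∫⁻ y, p t y x ∂μ ≤ 1)
    (hpCK : ∀ s t : ℝ, 0 < s → 0 < t → s + t ≤ T →
      ∀ x z : S, ∫⁻ y, p t z y * p s y x ∂μ = p (t + s) z x)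
    (x₀ : S)
    (a b C ε : ℝ) (ha : 0 < a) (hb : 0 < b) (hC : 0 < C) (hε : 0 < ε)
    (hest : ∀ y : S, ∀ τ : ℝ, 0 < τ → τ < ε →
      ∫⁻ z, ENNReal.ofReal (dist z y ^ a) * p τ z y ∂μ
        ≤ ENNReal.ofReal (C * τ ^ (1 + b))) :
    ∃ (Ω : Type) (_ : MeasurableSpace Ω) (P : Measure Ω) (Y : ℝ → Ω → S),
      P Set.univ ≤ 1 ∧
      (∀ t ∈ Set.Icc (0:ℝ) T, Measurable (Y t)) ∧
      -- (i) the process starts at `x₀`: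
      (∀ ω, Y 0 ω = x₀) ∧
      -- (ii) the finite-dimensional distributions:
      (∀ n : ℕ, 0 < n → ∀ t : ℕ → ℝ, t 0 = 0 → (∀ i < n, t i < t (i + 1)) → t n = T →
        ∀ B : Set (Fin n → S), MeasurableSet B →
          P {ω | (fun i : Fin n => Y (t (i.1 + 1)) ω) ∈ B}
            = ∫⁻ x in B,
                ∏ i ∈ Finset.range n,
                  p (t (i + 1) - t i) (pathOf x₀ n x (i + 1)) (pathOf x₀ n x i)
                ∂(Measure.pi fun _ : Fin n => μ)) ∧
      -- (iii) Hölder continuity of the paths: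
      (∀ ω, ∀ θ : ℝ, 0 < θ → θ < b / a →
        ∃ K : ℝ≥0, HolderOnWith K θ.toNNReal (fun s => Y s ω) (Set.Icc 0 T)) := by
  classical
  have : SecondCountableTopology S := UniformSpace.secondCountable_of_separable S
  let p' : ℝ → S → S → ℝ≥0∞ := fun t => if 0 < t ∧ t ≤ T then p t else 0
  have hp'_eq {t : ℝ} (h0 : 0 < t) (h1 : t ≤ T) : p' t = p t := if_pos ⟨h0, h1⟩
  have hp'_zero {t : ℝ} (h : ¬(0 < t ∧ t ≤ T)) : p' t = 0 := if_neg h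
  have hp : ∀ t, Measurable (Function.uncurry (p' t)) := fun t => by
    by_cases h : 0 < t ∧ t ≤ T
    · rw [hp'_eq h.1 h.2]; exact hpMeas t h.1 h.2
    · rw [hp'_zero h]; exact measurable_const (a := (0 : ℝ≥0∞))
  have hsub : ∀ t x, ∫⁻ y, p' t y x ∂μ ≤ 1 := fun t x => by
    by_cases h : 0 < t ∧ t ≤ T
    · rw [hp'_eq h.1 h.2]; exact hpSub t h.1 h.2 x
    · simp [hp'_zero h]
  have hCK : ∀ s t : ℝ, 0 < s → 0 < t → s + t ≤ T →
      ∀ x z : S, ∫⁻ y, p' t z y * p' s y x ∂μ = p' (t + s) z x := fun s t hs ht hst x z => by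
    rw [hp'_eq hs (by linarith), hp'_eq ht (by linarith), hp'_eq (by linarith) (by linarith)]
    exact hpCK s t hs ht hst x z
  obtain ⟨ν, hν1, hν⟩ := exists_path_law hT hp hsub hCK x₀
  have hmom : ∀ u v : ℝ, 0 ≤ u → u < v → v ≤ 1 → v - u < ε / T →
      ∫⁻ w, ENNReal.ofReal (dist (w (T * v)) (w (T * u)) ^ a) ∂ν ≤
        ENNReal.ofReal (C * T ^ (1 + b) * (v - u) ^ (1 + b)) := by
    intro u v hu huv hv huvε
    have huv' : T * u < T * v := by gcongr
    have hvT : T * v ≤ T := by nlinarith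
    have hτ : T * v - T * u < ε := by
      rw [lt_div_iff₀ hT] at huvε
      linarith
    rw [mul_assoc, ← Real.mul_rpow hT.le (by linarith), mul_sub]
    refine lintegral_dist_rpow_le hν hp hsub (by positivity) huv' hvT fun x => ?_
    rw [hp'_eq (by linarith) (by nlinarith)]
    exact hest x _ (by linarith) hτ
  have hX0 : ∀ᵐ w ∂ν, w (T * 0) = x₀ := by
    have hA : MeasurableSet {w : ℝ → S | ¬ w (T * 0) = x₀} :=
      (measurable_pi_apply (X := fun _ : ℝ => S) _ (measurableSet_singleton x₀)).compl
    rw [ae_iff, ← lintegral_indicator_one hA, hν [] (by simpa using hT) _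
      (measurable_one.indicator hA) (fun w w' h => ?_), lintegral_indicator_one hA, ← ae_iff]
    · rw [mul_zero]
      exact ae_resampleLaw_eq hp (by simpa using hT.ne) _ _ _
    · have h0 : w 0 = w' 0 := h 0 (Or.inl rfl)
      simp [Set.indicator_apply, h0]
  obtain ⟨Y, hYm, hY0, hYX, hYhol⟩ := exists_holder_modification
    (X := fun u (w : ℝ → S) => w (T * u)) (fun u => measurable_pi_apply _) ha hb
    (by positivity : 0 ≤ C * T ^ (1 + b)) (div_pos hε hT) hmom hX0
  have hmem {t : ℝ} (ht : t ∈ Set.Icc 0 T) : t / T ∈ Set.Icc (0 : ℝ) 1 :=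
    ⟨div_nonneg ht.1 hT.le, (div_le_one hT).2 ht.2⟩
  refine ⟨ℝ → S, inferInstance, ν, fun t => Y (t / T), hν1, fun t ht => hYm _ (hmem ht),
    fun ω => by simpa using hY0 ω, fun n hn t ht0 htlt htn B hB => ?_, fun ω θ hθ hθ' => ?_⟩
  · obtain ⟨m, rfl⟩ : ∃ m, n = m + 1 := ⟨n - 1, by omega⟩
    have hmono := lt_of_forall_lt_succ htlt
    have hIcc (i : ℕ) (hi : i ≤ m + 1) : t i ∈ Set.Icc 0 T := by
      constructor
      · rcases Nat.eq_zero_or_pos i with rfl | h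
        · exact ht0.ge
        · exact ht0 ▸ (hmono i hi 0 h).le
      · rcases hi.eq_or_lt with rfl | h
        · exact htn.le
        · exact htn ▸ (hmono _ le_rfl i h).le
    have hlist : (List.ofFn fun i : Fin (m + 1) => t (i.1 + 1)) =
        (List.ofFn fun i : Fin m => t (i.1 + 1)) ++ [T] := by
      rw [List.ofFn_succ_last]
      simp [htn]
    have hpair : (0 :: ((List.ofFn fun i : Fin m => t (i.1 + 1)) ++ [T])).Pairwise (· < ·) := by
      have : 0 :: ((List.ofFn fun i : Fin m => t (i.1 + 1)) ++ [T]) =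
          List.ofFn fun i : Fin (m + 2) => t i.1 := by
        rw [List.ofFn_succ, ← hlist]
        simp [ht0]
      rw [this, List.pairwise_ofFn]
      exact fun i j hij => hmono j (by omega) i hij
    have heval : Measurable fun w : ℝ → S => fun i : Fin (m + 1) => w (t (i.1 + 1)) :=
      measurable_pi_lambda _ fun i => measurable_pi_apply _
    have hYae : ∀ᵐ w ∂ν, ∀ i : Fin (m + 1), Y (t (i.1 + 1) / T) w = w (t (i.1 + 1)) :=
      ae_all_iff.2 fun i => by
        filter_upwards [hYX _ (hmem (hIcc (i.1 + 1) (by omega)))] with w hw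
        rw [hw, mul_div_cancel₀ _ hT.ne']
    have hset : {w : ℝ → S | (fun i : Fin (m + 1) => Y (t (i.1 + 1) / T) w) ∈ B} =ᵐ[ν]
        (fun w => fun i : Fin (m + 1) => w (t (i.1 + 1))) ⁻¹' B := by
      refine eventuallyEq_set.2 ?_
      filter_upwards [hYae] with w hw
      simp only [Set.mem_preimage, hw]
    rw [measure_congr hset, ← lintegral_indicator_one (heval hB), hν _ hpair _
      (measurable_one.indicator (heval hB)) ?_, ← hlist]
    · have := lintegral_resampleLaw_ofFn (μ := μ) hp htlt x₀ (fun _ => x₀)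
        (measurable_one.indicator hB : Measurable (B.indicator (1 : (Fin (m + 1) → S) → ℝ≥0∞)))
      rw [ht0] at this
      refine this.trans ?_
      rw [← lintegral_indicator hB]
      refine lintegral_congr fun z => ?_
      have hprod : ∀ i ∈ Finset.range (m + 1), p' (t (i + 1) - t i) = p (t (i + 1) - t i) :=
        fun i hi => by
          have hi' := Finset.mem_range.1 hi
          have h1 := (hIcc (i + 1) (by omega)).2
          have h2 := (hIcc i (by omega)).1
          exact hp'_eq (sub_pos.2 (htlt i hi')) (by linarith)
      rw [Finset.prod_congr rfl fun i hi => by rw [hprod i hi]]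
      by_cases hz : z ∈ B <;> simp [hz]
    · intro w w' h
      have : (fun i : Fin (m + 1) => w (t (i.1 + 1))) = fun i => w' (t (i.1 + 1)) := by
        ext i
        refine h _ (Or.inr ?_)
        have : t (i.1 + 1) ∈ List.ofFn fun i : Fin (m + 1) => t (i.1 + 1) :=
          (List.mem_ofFn).2 ⟨i, rfl⟩
        rw [hlist, List.mem_append, List.mem_singleton] at this
        exact this.symm
      exact congrArg (B.indicator (1 : (Fin (m + 1) → S) → ℝ≥0∞)) this
  · obtain ⟨K, hK, h⟩ := hYhol ω θ hθ hθ'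
    refine ⟨(K * (T ^ θ)⁻¹).toNNReal, fun s hs t ht => ?_⟩
    rw [edist_dist, edist_dist, Real.coe_toNNReal _ hθ.le,
      ENNReal.ofReal_rpow_of_nonneg dist_nonneg hθ.le, ← ENNReal.ofReal_coe_nnreal,
      Real.coe_toNNReal _ (by positivity), ← ENNReal.ofReal_mul (by positivity)]
    refine ENNReal.ofReal_le_ofReal ((h _ (hmem hs) _ (hmem ht)).trans (le_of_eq ?_))
    rw [← sub_div, abs_div, abs_of_pos hT, Real.div_rpow (abs_nonneg _) hT.le, Real.dist_eq,
      div_eq_mul_inv]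
    ring

end
end

section
/- Let (S,ρ) be a separable metric space, let T > 0 and x₀ ∈ S, and let C_{x₀}([0,T];S) be the set of continuous paths w : [0,T] → S with w(0) = x₀. Then the following two σ-algebras on C_{x₀}([0,T];S) coincide: (1) the Borel σ-algebra of the compact-open topology on C_{x₀}([0,T];S); (2) the trace on C_{x₀}([0,T];S) of the product σ-algebra 𝓑^{[0,T]} on S^{[0,T]}, i.e., {B ∩ C_{x₀}([0,T];S) : B ∈ 𝓑^{[0,T]}}, where 𝓑^{[0,T]} is the smallest σ-algebra on S^{[0,T]} for which all evaluation maps w ↦ w(t), t ∈ [0,T], are Borel measurable. -/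
open MeasureTheory Filter Topology
open scoped ENNReal NNReal

noncomputable section

/-- Sets `{f | f(K) ⊆ U}` with `K` compact and `U` open are measurable for the σ-algebra generated
by the evaluations, because a dense sequence of `K` detects a positive distance to `Uᶜ`. -/
theorem ContinuousMap.measurableSet_comap_pi_setOf_mapsTo {X S : Type*} [TopologicalSpace X]
    [SecondCountableTopology X] [PseudoEMetricSpace S] [MeasurableSpace S] [BorelSpace S]
    {K : Set X} {U : Set S} (hK : IsCompact K) (hU : IsOpen U) :
    MeasurableSet[MeasurableSpace.comap (fun (f : C(X, S)) (t : X) => f t) MeasurableSpace.pi]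
      {f : C(X, S) | Set.MapsTo f K U} := by
  obtain ⟨D, hDc, hDd⟩ := TopologicalSpace.exists_countable_dense K
  refine ⟨⋃ n : ℕ, ⋂ d ∈ D, {g | (n : ℝ≥0∞)⁻¹ ≤ Metric.infEDist (g (d : X)) Uᶜ}, ?_, ?_⟩
  · refine MeasurableSet.iUnion fun n => MeasurableSet.biInter hDc fun d _ => ?_
    exact measurableSet_le measurable_const (measurable_infEDist.comp (measurable_pi_apply _))
  · ext f
    simp only [Set.mem_preimage, Set.mem_iUnion, Set.mem_iInter, Set.mem_ofPred_eq]
    constructor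
    · rintro ⟨n, hn⟩ t ht
      have hclosed : IsClosed {x : K | (n : ℝ≥0∞)⁻¹ ≤ Metric.infEDist (f x) Uᶜ} :=
        isClosed_le continuous_const
          (Metric.continuous_infEDist.comp (f.continuous.comp continuous_subtype_val))
      have hle : (n : ℝ≥0∞)⁻¹ ≤ Metric.infEDist (f t) Uᶜ :=
        hclosed.closure_subset_iff.2 hn (hDd ⟨t, ht⟩)
      by_contra hmem
      rw [Metric.infEDist_zero_of_mem (show f t ∈ Uᶜ from hmem)] at hle
      simp at hle
    · intro h
      obtain ⟨r, hr, hlt⟩ := Metric.exists_pos_forall_lt_edist (hK.image f.continuous)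
        hU.isClosed_compl (Set.disjoint_compl_right_iff_subset.2 h.image_subset)
      obtain ⟨n, hn⟩ := ENNReal.exists_inv_nat_lt (ENNReal.coe_pos.2 hr).ne'
      exact ⟨n, fun d _ => hn.le.trans <| Metric.le_infEDist.2 fun y hy =>
        (hlt _ (Set.mem_image_of_mem f d.2) y hy).le⟩

/-- The Borel σ-algebra of the compact-open topology is generated by the evaluations. -/
theorem ContinuousMap.borel_eq_comap_pi {X S : Type*} [TopologicalSpace X]
    [SecondCountableTopology X] [LocallyCompactSpace X] [PseudoEMetricSpace S]
    [SecondCountableTopology S] [MeasurableSpace S] [BorelSpace S] :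
    borel C(X, S) =
      MeasurableSpace.comap (fun (f : C(X, S)) (t : X) => f t) MeasurableSpace.pi := by
  apply le_antisymm
  · rw [borel_eq_generateFrom_of_subbasis ContinuousMap.compactOpen_eq]
    refine MeasurableSpace.generateFrom_le ?_
    rintro _ ⟨K, hK, U, hU, rfl⟩
    exact measurableSet_comap_pi_setOf_mapsTo hK hU
  · borelize C(X, S)
    rw [← measurable_iff_comap_le, measurable_pi_iff]
    exact fun t => (continuous_eval_const t).measurable

/-- Remark 2.12: on `C_{x₀}([0,T];S)` the Borel σ-algebra of the compact-open topology
coincides with the trace of the product σ-algebra `𝓑^{[0,T]}` on `S^{[0,T]}`, the trace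
σ-algebra being the pullback (comap) of the product σ-algebra under the inclusion
`C_{x₀}([0,T];S) ↪ S^{[0,T]}`, `w ↦ (t ↦ w(t))`. -/
theorem borel_compactOpen_eq_trace_product
    {S : Type} [MetricSpace S] [TopologicalSpace.SeparableSpace S]
    [MeasurableSpace S] [BorelSpace S]
    (T : ℝ) (hT : 0 < T) (h0 : (0:ℝ) ∈ Set.Icc (0:ℝ) T) (x₀ : S) :
    borel {w : C(Set.Icc (0:ℝ) T, S) // w ⟨0, h0⟩ = x₀}
      = MeasurableSpace.comap
          (fun (w : {w : C(Set.Icc (0:ℝ) T, S) // w ⟨0, h0⟩ = x₀})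
               (t : Set.Icc (0:ℝ) T) => w.1 t)
          MeasurableSpace.pi := by
  have := UniformSpace.secondCountable_of_separable S
  rw [show borel {w : C(Set.Icc (0:ℝ) T, S) // w ⟨0, h0⟩ = x₀} =
      (borel C(Set.Icc (0:ℝ) T, S)).comap Subtype.val from borel_comap,
    ContinuousMap.borel_eq_comap_pi, MeasurableSpace.comap_comp]
  rfl

end
end

section
/- Let (S,ρ,μ) be a metric measure space, let T > 0, let p be a substochastic transition function on S, and fix x₀ ∈ S. Suppose that for all x₀, y₀ ∈ S there exist a Wiener measure 𝕎_{x₀} on C_{x₀}([0,T];S) induced by p and conditional Wiener measures 𝕎_{x₀}^{y₀} on C_{x₀}^{y₀}([0,T];S) induced by p. Let f : C_{x₀}([0,T];S) → [−∞,+∞] be either 𝕎_{x₀}-integrable or nonnegative measurable. Then ∫_{C_{x₀}([0,T];S)} f(w) d𝕎_{x₀}(w) = ∫_S ∫_{C_{x₀}^{y₀}([0,T];S)} f(w) d𝕎_{x₀}^{y₀}(w) dμ(y₀). -/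
open MeasureTheory Filter Topology
open scoped ENNReal NNReal

noncomputable section

/-- The space `C_{x₀}([0,T];S)` of continuous paths `[0,T] → S` starting at `x₀`. -/
abbrev PathSpace (S : Type) [TopologicalSpace S] (T : ℝ)
    (h0 : (0:ℝ) ∈ Set.Icc (0:ℝ) T) (x₀ : S) : Type :=
  {w : C(Set.Icc (0:ℝ) T, S) // w ⟨0, h0⟩ = x₀}

instance (S : Type) [TopologicalSpace S] (T : ℝ)
    (h0 : (0:ℝ) ∈ Set.Icc (0:ℝ) T) (x₀ : S) :
    MeasurableSpace (PathSpace S T h0 x₀) := borel _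

/-- The space `C_{x₀}^{y₀}([0,T];S)` of continuous paths `[0,T] → S` from `x₀` to `y₀`. -/
abbrev BridgeSpace (S : Type) [TopologicalSpace S] (T : ℝ)
    (h0 : (0:ℝ) ∈ Set.Icc (0:ℝ) T) (hTm : T ∈ Set.Icc (0:ℝ) T) (x₀ y₀ : S) : Type :=
  {w : C(Set.Icc (0:ℝ) T, S) // w ⟨0, h0⟩ = x₀ ∧ w ⟨T, hTm⟩ = y₀}

instance (S : Type) [TopologicalSpace S] (T : ℝ)
    (h0 : (0:ℝ) ∈ Set.Icc (0:ℝ) T) (hTm : T ∈ Set.Icc (0:ℝ) T) (x₀ y₀ : S) :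
    MeasurableSpace (BridgeSpace S T h0 hTm x₀ y₀) := borel _

/-- The defining property of the Wiener measure induced by `p`. -/
def IsWienerMeasure {S : Type} [TopologicalSpace S] [MeasurableSpace S]
    (μ : Measure S) (p : ℝ → S → S → ℝ≥0∞) (T : ℝ)
    (h0 : (0:ℝ) ∈ Set.Icc (0:ℝ) T) (x₀ : S)
    (W : Measure (PathSpace S T h0 x₀)) : Prop :=
  ∀ n : ℕ, 0 < n → ∀ t : ℕ → ℝ, t 0 = 0 → (∀ i < n, t i < t (i + 1)) → t n = T →
    ∀ hmem : ∀ i, i ≤ n → t i ∈ Set.Icc (0:ℝ) T,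
    ∀ U : Fin n → Set S, (∀ i, IsOpen (U i)) →
      W {w | ∀ i : Fin n, w.1 ⟨t (i.1 + 1), hmem (i.1 + 1) i.isLt⟩ ∈ U i}
        = ∫⁻ x in Set.univ.pi U,
            ∏ i ∈ Finset.range n,
              p (t (i + 1) - t i) (pathOf x₀ n x (i + 1)) (pathOf x₀ n x i)
            ∂(Measure.pi fun _ : Fin n => μ)

/-- The defining property of the conditional Wiener measure induced by `p`. -/
def IsCondWienerMeasure {S : Type} [TopologicalSpace S] [MeasurableSpace S]
    (μ : Measure S) (p : ℝ → S → S → ℝ≥0∞) (T : ℝ)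
    (h0 : (0:ℝ) ∈ Set.Icc (0:ℝ) T) (hTm : T ∈ Set.Icc (0:ℝ) T) (x₀ y₀ : S)
    (W : Measure (BridgeSpace S T h0 hTm x₀ y₀)) : Prop :=
  ∀ n : ℕ, 0 < n → ∀ t : ℕ → ℝ, t 0 = 0 → (∀ i < n, t i < t (i + 1)) → t n < T →
    ∀ hmem : ∀ i, i ≤ n → t i ∈ Set.Icc (0:ℝ) T,
    ∀ U : Fin n → Set S, (∀ i, IsOpen (U i)) →
      W {w | ∀ i : Fin n, w.1 ⟨t (i.1 + 1), hmem (i.1 + 1) i.isLt⟩ ∈ U i}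
        = ∫⁻ x in Set.univ.pi U,
            p (T - t n) y₀ (pathOf x₀ n x n) *
            ∏ i ∈ Finset.range n,
              p (t (i + 1) - t i) (pathOf x₀ n x (i + 1)) (pathOf x₀ n x i)
            ∂(Measure.pi fun _ : Fin n => μ)

namespace WienerDisintegration

/-- Bochner integration against `μ.bind κ` for a measurable family of measures `κ`. -/
lemma integral_bind {α β : Type*} [MeasurableSpace α] [MeasurableSpace β] {μ : Measure α}
    {κ : α → Measure β} (hκ : Measurable κ) {f : β → ℝ} (hf : Integrable f (μ.bind κ)) :
    ∫ b, f b ∂(μ.bind κ) = ∫ a, ∫ b, f b ∂(κ a) ∂μ := by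
  have key : ∀ g : β → ℝ, Integrable g (μ.bind κ) →
      ∫⁻ b, ENNReal.ofReal (g b) ∂(μ.bind κ) = ∫⁻ a, ∫⁻ b, ENNReal.ofReal (g b) ∂(κ a) ∂μ ∧
      AEMeasurable (fun a ↦ ∫⁻ b, ENNReal.ofReal (g b) ∂(κ a)) μ ∧
      ∫⁻ a, ∫⁻ b, ENNReal.ofReal (g b) ∂(κ a) ∂μ ≠ ∞ := by
    intro g hg
    have hm : AEMeasurable (fun b ↦ ENNReal.ofReal (g b)) (μ.bind κ) :=
      hg.aestronglyMeasurable.aemeasurable.ennreal_ofReal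
    have hb := Measure.lintegral_bind hκ.aemeasurable hm
    refine ⟨hb, ?_, hb ▸ hg.lintegral_lt_top.ne⟩
    refine ((Measure.measurable_lintegral hm.measurable_mk).comp hκ).aemeasurable.congr ?_
    filter_upwards [Measure.ae_ae_of_ae_bind hκ.aemeasurable hm.ae_eq_mk] with a ha
    exact (lintegral_congr_ae ha).symm
  obtain ⟨hp, hpm, hpt⟩ := key f hf
  obtain ⟨hn, hnm, hnt⟩ := key (fun b ↦ -f b) hf.neg
  have hfm : ∀ᵐ a ∂μ, AEStronglyMeasurable f (κ a) := by
    filter_upwards [Measure.ae_ae_of_ae_bind hκ.aemeasurable hf.1.ae_eq_mk] with a ha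
    exact ⟨_, hf.1.stronglyMeasurable_mk, ha⟩
  have hpa := ae_lt_top' hpm hpt
  have hna := ae_lt_top' hnm hnt
  rw [integral_eq_lintegral_pos_part_sub_lintegral_neg_part hf, hp, hn,
    ← integral_toReal hpm hpa, ← integral_toReal hnm hna,
    ← integral_sub (integrable_toReal_of_lintegral_ne_top hpm hpt)
      (integrable_toReal_of_lintegral_ne_top hnm hnt)]
  refine integral_congr_ae ?_
  filter_upwards [hpa, hna, hfm] with a h₁ h₂ h₃
  refine (integral_eq_lintegral_pos_part_sub_lintegral_neg_part ⟨h₃, ?_⟩).symm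
  have hle : ∀ b, ‖f b‖ₑ ≤ ENNReal.ofReal (f b) + ENNReal.ofReal (-f b) := fun b ↦ by
    rw [← ofReal_norm, Real.norm_eq_abs]
    rcases le_total 0 (f b) with h | h
    · rw [abs_of_nonneg h]; exact le_self_add
    · rw [abs_of_nonpos h]; exact le_add_self
  refine (lintegral_mono hle).trans_lt ?_
  rw [lintegral_add_left' h₃.aemeasurable.ennreal_ofReal]
  exact ENNReal.add_lt_top.2 ⟨h₁, h₂⟩

variable {S : Type} [MetricSpace S] {T : ℝ}

instance (h0 : (0:ℝ) ∈ Set.Icc (0:ℝ) T) (x₀ : S) : BorelSpace (PathSpace S T h0 x₀) := ⟨rfl⟩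

instance (h0 : (0:ℝ) ∈ Set.Icc (0:ℝ) T) (hTm : T ∈ Set.Icc (0:ℝ) T) (x₀ y₀ : S) :
    BorelSpace (BridgeSpace S T h0 hTm x₀ y₀) := ⟨rfl⟩

/-- The Borel sets of the path space are generated by the evaluations. -/
lemma borel_pathSpace_le [TopologicalSpace.SeparableSpace S] [MeasurableSpace S] [BorelSpace S]
    (h0 : (0:ℝ) ∈ Set.Icc (0:ℝ) T) (x₀ : S) (m : MeasurableSpace (PathSpace S T h0 x₀))
    (hm : ∀ t, Measurable[m] fun w : PathSpace S T h0 x₀ ↦ w.1 t) :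
    borel (PathSpace S T h0 x₀) ≤ m := by
  have : SecondCountableTopology S := UniformSpace.secondCountable_of_separable S
  have : Nonempty (Set.Icc (0:ℝ) T) := ⟨⟨0, h0⟩⟩
  have hball : ∀ (v : PathSpace S T h0 x₀) (r : ℝ),
      MeasurableSet[m] (Metric.closedBall v r) := by
    intro v r
    have : Metric.closedBall v r = ⋂ k : ℕ, (fun w : PathSpace S T h0 x₀ ↦
        w.1 (TopologicalSpace.denseSeq _ k)) ⁻¹'
          Metric.closedBall (v.1 (TopologicalSpace.denseSeq _ k)) r := by
      ext w
      simp only [Metric.mem_closedBall, Set.mem_iInter, Set.mem_preimage]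
      rw [Subtype.dist_eq, ContinuousMap.dist_le_iff_of_nonempty]
      refine ⟨fun h k ↦ h _, fun h ↦ ?_⟩
      have hc : IsClosed {s | dist (w.1 s) (v.1 s) ≤ r} :=
        isClosed_le (w.1.continuous.dist v.1.continuous) continuous_const
      exact fun s ↦ (TopologicalSpace.denseRange_denseSeq (Set.Icc (0:ℝ) T)).induction_on
        s hc h
    rw [this]
    exact MeasurableSet.iInter fun k ↦ hm _ Metric.isClosed_closedBall.measurableSet
  have hbasis : TopologicalSpace.IsTopologicalBasis
      {s : Set (PathSpace S T h0 x₀) | ∃ v r, s = Metric.ball v r} := by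
    refine TopologicalSpace.isTopologicalBasis_of_isOpen_of_nhds ?_ ?_
    · rintro _ ⟨v, r, rfl⟩
      exact Metric.isOpen_ball
    · intro v s hv hs
      obtain ⟨r, hr, hrs⟩ := Metric.isOpen_iff.1 hs v hv
      exact ⟨_, ⟨v, r, rfl⟩, Metric.mem_ball_self hr, hrs⟩
  rw [hbasis.borel_eq_generateFrom]
  refine MeasurableSpace.generateFrom_le ?_
  rintro _ ⟨v, r, rfl⟩
  have : Metric.ball v r = ⋃ k : ℕ, Metric.closedBall v (r - 1 / (k + 1)) := by
    ext w
    simp only [Metric.mem_ball, Set.mem_iUnion, Metric.mem_closedBall]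
    constructor
    · intro h
      obtain ⟨k, hk⟩ := exists_nat_one_div_lt (sub_pos.2 h)
      exact ⟨k, by linarith⟩
    · rintro ⟨k, hk⟩
      have : (0:ℝ) < 1 / (k + 1) := by positivity
      linarith
  rw [this]
  exact MeasurableSet.iUnion fun k ↦ hball _ _

lemma exists_partition (hT : 0 < T) (F : Finset ℝ) (hF : ↑F ⊆ Set.Ioo 0 T) :
    ∃ t : ℕ → ℝ, t 0 = 0 ∧ (∀ i < F.card + 1, t i < t (i + 1)) ∧ t (F.card + 1) = T ∧
      ∀ s, s ∈ F ↔ ∃ i < F.card, t (i + 1) = s := by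
  refine ⟨fun i ↦ if i = 0 then 0 else
    if h : i - 1 < F.card then F.orderEmbOfFin rfl ⟨i - 1, h⟩ else T, ?_, ?_, ?_, ?_⟩
  · simp
  · intro i hi
    have hmem : ∀ j, F.orderEmbOfFin rfl j ∈ Set.Ioo 0 T :=
      fun j ↦ hF (F.orderEmbOfFin_mem rfl j)
    rcases i with _ | i
    · by_cases h : 0 < F.card
      · simpa [h] using (hmem ⟨0, h⟩).1
      · simpa [h] using hT
    · have hi' : i < F.card := by omega
      by_cases h : i + 1 < F.card
      · simp [hi', h]
      · simpa [hi', h] using (hmem ⟨i, hi'⟩).2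
  · simp
  · intro s
    have := Set.ext_iff.1 (F.range_orderEmbOfFin rfl) s
    rw [Finset.mem_coe] at this
    rw [← this]
    constructor
    · rintro ⟨j, rfl⟩
      exact ⟨j, j.2, by simp⟩
    · rintro ⟨i, hi, rfl⟩
      exact ⟨⟨i, hi⟩, by simp [hi]⟩

lemma pathOf_snoc_of_le {S : Type*} (x₀ : S) {n : ℕ} (x : Fin n → S) (y : S) {i : ℕ}
    (hi : i ≤ n) :
    pathOf x₀ (n + 1) (Fin.snoc x y : Fin (n + 1) → S) i = pathOf x₀ n x i := by
  rcases i with _ | i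
  · simp [pathOf]
  · have h : i < n := by omega
    simp [pathOf, Fin.snoc, h, show i < n + 1 by omega]

lemma pathOf_snoc_succ {S : Type*} (x₀ : S) {n : ℕ} (x : Fin n → S) (y : S) :
    pathOf x₀ (n + 1) (Fin.snoc x y : Fin (n + 1) → S) (n + 1) = y := by
  simp [pathOf, Fin.snoc]

lemma measurable_pathOf {S : Type*} [MeasurableSpace S] (x₀ : S) (n i : ℕ) :
    Measurable fun x : Fin n → S ↦ pathOf x₀ n x i := by
  unfold pathOf
  split_ifs
  · exact measurable_pi_apply _
  · exact measurable_const

lemma setLIntegral_pi_snoc {S : Type*} [MeasurableSpace S] (μ : Measure S) [SigmaFinite μ] {n : ℕ}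
    {U : Fin n → Set S} (hU : ∀ i, MeasurableSet (U i)) {V : Set S} (hV : MeasurableSet V)
    {g : (Fin (n + 1) → S) → ℝ≥0∞} (hg : Measurable g) :
    ∫⁻ z in Set.univ.pi (Fin.snoc U V : Fin (n + 1) → Set S), g z
        ∂(Measure.pi fun _ : Fin (n + 1) => μ)
      = ∫⁻ y in V, ∫⁻ x in Set.univ.pi U, g (Fin.snoc x y : Fin (n + 1) → S)
          ∂(Measure.pi fun _ : Fin n => μ) ∂μ := by
  have hmp := (measurePreserving_piFinSuccAbove (fun _ : Fin (n + 1) ↦ μ) (Fin.last n)).symm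
  have hms : MeasurableSet (Set.univ.pi (Fin.snoc U V : Fin (n + 1) → Set S)) := by
    refine MeasurableSet.univ_pi fun i ↦ ?_
    induction i using Fin.lastCases with
    | last => simpa using hV
    | cast i => simpa using hU i
  have he : ∀ q : S × (Fin n → S),
      (MeasurableEquiv.piFinSuccAbove (fun _ : Fin (n + 1) ↦ S) (Fin.last n)).symm q
        = (Fin.snoc q.2 q.1 : Fin (n + 1) → S) := fun q ↦
    Fin.insertNth_last' q.1 q.2
  have hpre : (MeasurableEquiv.piFinSuccAbove (fun _ : Fin (n + 1) ↦ S) (Fin.last n)).symm ⁻¹'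
      (Set.univ.pi (Fin.snoc U V : Fin (n + 1) → Set S)) = V ×ˢ Set.univ.pi U := by
    ext q
    simp only [Set.mem_preimage, he, Set.mem_pi, Set.mem_univ, true_implies, Set.mem_prod]
    rw [Fin.forall_fin_succ']
    simp [and_comm]
  have hgs : Measurable fun q : S × (Fin n → S) ↦ g (Fin.snoc q.2 q.1 : Fin (n + 1) → S) := by
    simp_rw [← he]
    exact hg.comp (MeasurableEquiv.measurable _)
  rw [← hmp.setLIntegral_comp_preimage hms hg, hpre, ← Measure.prod_restrict]
  simp_rw [he]
  exact lintegral_prod _ hgs.aemeasurable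

/-- Paths whose values at the times in `F` lie in the sets `U` and whose endpoint lies in `V`. -/
def cylinder (h0 : (0:ℝ) ∈ Set.Icc (0:ℝ) T) (hTm : T ∈ Set.Icc (0:ℝ) T) (x₀ : S)
    (F : Finset ℝ) (U : ℝ → Set S) (V : Set S) : Set (PathSpace S T h0 x₀) :=
  {w | (∀ s ∈ F, w.1 (Set.projIcc 0 T h0.2 s) ∈ U s) ∧ w.1 ⟨T, hTm⟩ ∈ V}

/-- The cylinders over finite nonempty sets of interior times and open sets. -/
def cylinders (S : Type) [MetricSpace S] {T : ℝ} (h0 : (0:ℝ) ∈ Set.Icc (0:ℝ) T)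
    (hTm : T ∈ Set.Icc (0:ℝ) T) (x₀ : S) : Set (Set (PathSpace S T h0 x₀)) :=
  {s | ∃ (F : Finset ℝ) (U : ℝ → Set S) (V : Set S), F.Nonempty ∧ ↑F ⊆ Set.Ioo 0 T ∧
    (∀ r, IsOpen (U r)) ∧ IsOpen V ∧ s = cylinder h0 hTm x₀ F U V}

lemma isPiSystem_cylinders (h0 : (0:ℝ) ∈ Set.Icc (0:ℝ) T) (hTm : T ∈ Set.Icc (0:ℝ) T) (x₀ : S) :
    IsPiSystem (cylinders S h0 hTm x₀) := by
  classical
  rintro _ ⟨F, U, V, hF, hFT, hU, hV, rfl⟩ _ ⟨F', U', V', hF', hFT', hU', hV', rfl⟩ -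
  refine ⟨F ∪ F', fun r ↦ (if r ∈ F then U r else Set.univ) ∩ (if r ∈ F' then U' r else Set.univ),
    V ∩ V', hF.mono Finset.subset_union_left, ?_, fun r ↦ ?_, hV.inter hV', ?_⟩
  · rw [Finset.coe_union]
    exact Set.union_subset hFT hFT'
  · refine IsOpen.inter ?_ ?_ <;> split_ifs <;> simp [hU, hU']
  · ext w
    simp only [cylinder, Set.mem_inter_iff, Set.mem_ofPred_eq, Finset.mem_union]
    constructor
    · rintro ⟨⟨h₁, h₂⟩, h₃, h₄⟩
      refine ⟨fun s _ ↦ ⟨?_, ?_⟩, h₂, h₄⟩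
      · split_ifs with h
        exacts [h₁ s h, trivial]
      · split_ifs with h
        exacts [h₃ s h, trivial]
    · rintro ⟨h, h₂, h₄⟩
      refine ⟨⟨fun s hs ↦ ?_, h₂⟩, fun s hs ↦ ?_, h₄⟩
      · simpa [hs] using (h s (Or.inl hs)).1
      · simpa [hs] using (h s (Or.inr hs)).2

lemma univ_mem_cylinders (hT : 0 < T) (h0 : (0:ℝ) ∈ Set.Icc (0:ℝ) T)
    (hTm : T ∈ Set.Icc (0:ℝ) T) (x₀ : S) : Set.univ ∈ cylinders S h0 hTm x₀ :=
  ⟨{T / 2}, fun _ ↦ Set.univ, Set.univ, Finset.singleton_nonempty _,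
    by simp [hT], fun _ ↦ isOpen_univ, isOpen_univ, by simp [cylinder]⟩

lemma generateFrom_cylinders [TopologicalSpace.SeparableSpace S] [MeasurableSpace S] [BorelSpace S]
    (hT : 0 < T) (h0 : (0:ℝ) ∈ Set.Icc (0:ℝ) T) (hTm : T ∈ Set.Icc (0:ℝ) T) (x₀ : S) :
    borel (PathSpace S T h0 x₀) = MeasurableSpace.generateFrom (cylinders S h0 hTm x₀) := by
  refine le_antisymm (borel_pathSpace_le h0 x₀ _ fun t ↦ ?_) ?_
  · refine @measurable_of_isOpen _ _ _ _ _ (MeasurableSpace.generateFrom _) _ fun O hO ↦ ?_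
    rcases eq_or_lt_of_le t.2.1 with h | h
    · have ht : t = ⟨0, h0⟩ := Subtype.ext h.symm
      subst ht
      have : (fun w : PathSpace S T h0 x₀ ↦ w.1 ⟨0, h0⟩) = fun _ ↦ x₀ := funext fun w ↦ w.2
      rw [this]
      by_cases hx : x₀ ∈ O <;> simp [hx]
    rcases eq_or_lt_of_le t.2.2 with h' | h'
    · refine MeasurableSpace.measurableSet_generateFrom
        ⟨{T / 2}, fun _ ↦ Set.univ, O, Finset.singleton_nonempty _, by simp [hT],
          fun _ ↦ isOpen_univ, hO, ?_⟩
      have ht : t = ⟨T, hTm⟩ := Subtype.ext h'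
      subst ht
      ext w
      simp [cylinder]
    · refine MeasurableSpace.measurableSet_generateFrom
        ⟨{t.1}, fun _ ↦ O, Set.univ, Finset.singleton_nonempty _, by simp [h, h'],
          fun _ ↦ hO, isOpen_univ, ?_⟩
      ext w
      simp [cylinder]
  · refine MeasurableSpace.generateFrom_le ?_
    rintro _ ⟨F, U, V, -, -, hU, hV, rfl⟩
    have hc : ∀ t, Continuous fun w : PathSpace S T h0 x₀ ↦ w.1 t := fun t ↦
      (continuous_eval_const t).comp continuous_subtype_val
    have : cylinder h0 hTm x₀ F U V =
        (⋂ s ∈ F, (fun w : PathSpace S T h0 x₀ ↦ w.1 (Set.projIcc 0 T h0.2 s)) ⁻¹' U s) ∩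
          (fun w : PathSpace S T h0 x₀ ↦ w.1 ⟨T, hTm⟩) ⁻¹' V := by
      ext w
      simp [cylinder]
    rw [this]
    exact MeasurableSpace.measurableSet_generateFrom
      ((isOpen_biInter_finset fun s _ ↦ (hU s).preimage (hc _)).inter (hV.preimage (hc _)))

/-- The inclusion of the bridges into the paths. -/
def bridgeToPath (h0 : (0:ℝ) ∈ Set.Icc (0:ℝ) T) (hTm : T ∈ Set.Icc (0:ℝ) T) (x₀ y₀ : S)
    (w : BridgeSpace S T h0 hTm x₀ y₀) : PathSpace S T h0 x₀ := ⟨w.1, w.2.1⟩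

lemma measurable_bridgeToPath (h0 : (0:ℝ) ∈ Set.Icc (0:ℝ) T) (hTm : T ∈ Set.Icc (0:ℝ) T)
    (x₀ y₀ : S) : Measurable (bridgeToPath h0 hTm x₀ y₀) :=
  (continuous_subtype_val.subtype_mk fun w ↦ w.2.1).measurable

section Cylinder

variable [MeasurableSpace S] {μ : Measure S}
  {h0 : (0:ℝ) ∈ Set.Icc (0:ℝ) T} {hTm : T ∈ Set.Icc (0:ℝ) T} {p : ℝ → S → S → ℝ≥0∞} {x₀ : S}

/-- The disintegration formula on cylinders. -/
lemma wiener_cylinder [BorelSpace S] [SigmaFinite μ] (hT : 0 < T)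
    (hpMeas : ∀ t : ℝ, 0 < t → t ≤ T → Measurable (Function.uncurry (p t)))
    {W : Measure (PathSpace S T h0 x₀)} (hW : IsWienerMeasure μ p T h0 x₀ W)
    {Wb : (y₀ : S) → Measure (BridgeSpace S T h0 hTm x₀ y₀)}
    (hWb : ∀ y₀, IsCondWienerMeasure μ p T h0 hTm x₀ y₀ (Wb y₀))
    {A : Set (PathSpace S T h0 x₀)} (hA : A ∈ cylinders S h0 hTm x₀) :
    Measurable (fun y ↦ Wb y (bridgeToPath h0 hTm x₀ y ⁻¹' A)) ∧
      W A = ∫⁻ y, Wb y (bridgeToPath h0 hTm x₀ y ⁻¹' A) ∂μ := by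
  obtain ⟨F, U, V, hF, hFT, hU, hV, rfl⟩ := hA
  obtain ⟨t, ht0, htlt, htT, htF⟩ := exists_partition hT F hFT
  have hn : 0 < F.card := hF.card_pos
  set n := F.card
  have hmem : ∀ i, i ≤ n + 1 → t i ∈ Set.Icc 0 T := by
    rintro (_ | i) hi
    · rw [ht0]; exact h0
    · rcases (show i < n ∨ i = n by omega) with h | rfl
      · exact Set.Ioo_subset_Icc_self (hFT ((htF _).2 ⟨i, h, rfl⟩))
      · rw [htT]; exact hTm
  have hdiff : ∀ i < n + 1, 0 < t (i + 1) - t i ∧ t (i + 1) - t i ≤ T := fun i hi ↦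
    ⟨sub_pos.2 (htlt i hi), by linarith [(hmem (i + 1) hi).2, (hmem i hi.le).1]⟩
  have htn : t n < T := htT ▸ htlt n (Nat.lt_succ_self n)
  have hiff : ∀ w : PathSpace S T h0 x₀, (∀ s ∈ F, w.1 (Set.projIcc 0 T h0.2 s) ∈ U s) ↔
      ∀ i : Fin n, w.1 ⟨t (i.1 + 1), hmem (i.1 + 1) (by omega)⟩ ∈ U (t (i.1 + 1)) := by
    intro w
    constructor
    · intro h i
      have := h _ ((htF _).2 ⟨i, i.2, rfl⟩)
      rwa [Set.projIcc_of_mem h0.2 (hmem (i + 1) (by omega))] at this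
    · intro h s hs
      obtain ⟨i, hi, rfl⟩ := (htF s).1 hs
      rw [Set.projIcc_of_mem h0.2 (hmem (i + 1) (by omega))]
      exact h ⟨i, hi⟩
  let U' : Fin n → Set S := fun i ↦ U (t (i.1 + 1))
  let G : (Fin n → S) → ℝ≥0∞ := fun x ↦ ∏ i ∈ Finset.range n,
    p (t (i + 1) - t i) (pathOf x₀ n x (i + 1)) (pathOf x₀ n x i)
  have hGm : Measurable G := Finset.measurable_prod _ fun i hi ↦ by
    obtain ⟨h₁, h₂⟩ := hdiff i (by have := Finset.mem_range.1 hi; omega)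
    exact (hpMeas _ h₁ h₂).comp ((measurable_pathOf x₀ n _).prodMk (measurable_pathOf x₀ n _))
  have hWbv : ∀ y, Wb y (bridgeToPath h0 hTm x₀ y ⁻¹' cylinder h0 hTm x₀ F U V)
      = V.indicator (fun y ↦ ∫⁻ x in Set.univ.pi U', p (T - t n) y (pathOf x₀ n x n) * G x
          ∂(Measure.pi fun _ : Fin n => μ)) y := by
    intro y
    by_cases hy : y ∈ V
    · rw [Set.indicator_of_mem hy, ← hWb y n hn t ht0 (fun i hi ↦ htlt i (by omega)) htn
        (fun i hi ↦ hmem i (by omega)) U' (fun i ↦ hU _)]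
      congr 1
      ext w
      have hwy : w.1 ⟨T, hTm⟩ ∈ V := by rw [w.2.2]; exact hy
      exact ⟨fun h ↦ (hiff _).1 h.1, fun h ↦ ⟨(hiff _).2 h, hwy⟩⟩
    · rw [Set.indicator_of_notMem hy]
      convert measure_empty (μ := Wb y)
      ext w
      simp only [Set.mem_preimage, Set.mem_empty_iff_false, iff_false]
      intro h
      have := h.2
      rw [show (bridgeToPath h0 hTm x₀ y w).1 ⟨T, hTm⟩ = y from w.2.2] at this
      exact hy this
  have hKm : Measurable fun q : S × (Fin n → S) ↦ p (T - t n) q.1 (pathOf x₀ n q.2 n) * G q.2 := by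
    obtain ⟨h₁, h₂⟩ := hdiff n (Nat.lt_succ_self n)
    rw [htT] at h₁ h₂
    exact ((hpMeas _ h₁ h₂).comp (measurable_fst.prodMk
      ((measurable_pathOf x₀ n n).comp measurable_snd))).mul (hGm.comp measurable_snd)
  simp_rw [hWbv]
  refine ⟨(Measurable.lintegral_prod_right hKm).indicator hV.measurableSet, ?_⟩
  rw [lintegral_indicator hV.measurableSet]
  have hset : cylinder h0 hTm x₀ F U V = {w | ∀ i : Fin (n + 1),
      w.1 ⟨t (i.1 + 1), hmem (i.1 + 1) i.isLt⟩ ∈ (Fin.snoc U' V : Fin (n + 1) → Set S) i} := by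
    ext w
    simp only [cylinder, Set.mem_ofPred_eq, hiff]
    rw [Fin.forall_fin_succ']
    simp [U', htT]
  have hopen : ∀ i, IsOpen ((Fin.snoc U' V : Fin (n + 1) → Set S) i) := by
    intro i
    induction i using Fin.lastCases with
    | last => simpa using hV
    | cast i => simpa using hU _
  rw [hset, hW (n + 1) (Nat.succ_pos n) t ht0 htlt htT hmem _ hopen,
    setLIntegral_pi_snoc μ (fun i ↦ (hU _).measurableSet) hV.measurableSet]
  · refine lintegral_congr fun y ↦ lintegral_congr fun x ↦ ?_
    rw [Finset.prod_range_succ, mul_comm, pathOf_snoc_succ, pathOf_snoc_of_le _ _ _ le_rfl, htT]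
    congr 1
    refine Finset.prod_congr rfl fun i hi ↦ ?_
    have := Finset.mem_range.1 hi
    rw [pathOf_snoc_of_le _ _ _ (by omega), pathOf_snoc_of_le _ _ _ (by omega)]
  · refine Finset.measurable_prod _ fun i hi ↦ ?_
    obtain ⟨h₁, h₂⟩ := hdiff i (Finset.mem_range.1 hi)
    exact (hpMeas _ h₁ h₂).comp ((measurable_pathOf x₀ _ _).prodMk (measurable_pathOf x₀ _ _))

/-- The total mass of the conditional Wiener measure. -/
lemma condWiener_univ (hT : 0 < T)
    (hpMeas : ∀ t : ℝ, 0 < t → t ≤ T → Measurable (Function.uncurry (p t)))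
    (hpCK : ∀ s t : ℝ, 0 < s → 0 < t → s + t ≤ T →
      ∀ x z : S, ∫⁻ y, p t z y * p s y x ∂μ = p (t + s) z x)
    {y₀ : S} {Wb : Measure (BridgeSpace S T h0 hTm x₀ y₀)}
    (hWb : IsCondWienerMeasure μ p T h0 hTm x₀ y₀ Wb) :
    Wb Set.univ = p T y₀ x₀ := by
  have h := hWb 1 one_pos (fun i ↦ i * (T / 2)) (by simp)
    (fun i _ ↦ by push_cast; linarith) (by push_cast; linarith)
    (fun i hi ↦ by
      have : (i : ℝ) ≤ 1 := by exact_mod_cast hi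
      constructor
      · positivity
      · nlinarith) (fun _ ↦ Set.univ) (fun _ ↦ isOpen_univ)
  have hT2 : T - T / 2 = T / 2 := by ring
  simp only [Set.mem_univ, implies_true, Set.ofPred_true, Set.pi_univ,
    Measure.restrict_univ, Finset.range_one, Finset.prod_singleton] at h
  rw [h]
  have hm : Measurable fun x ↦ p (T / 2) y₀ x * p (T / 2) x x₀ :=
    ((hpMeas _ (by linarith) (by linarith)).comp (measurable_const.prodMk measurable_id)).mul
      ((hpMeas _ (by linarith) (by linarith)).comp (measurable_id.prodMk measurable_const))
  have hck := hpCK (T / 2) (T / 2) (by linarith) (by linarith) (by linarith) x₀ y₀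
  rw [add_halves] at hck
  rw [← hck, ← (measurePreserving_funUnique μ (Fin 1)).lintegral_comp hm]
  refine lintegral_congr fun x ↦ ?_
  simp [pathOf, hT2]

end Cylinder

end WienerDisintegration

open WienerDisintegration in
/-- Lemma 2.19 (disintegration of the Wiener measure over the endpoint): integration with
respect to the Wiener measure equals integration of the conditional Wiener integrals over
the endpoint, both for nonnegative measurable and for integrable functions. -/
theorem wiener_disintegration
    {S : Type} [MetricSpace S] [CompleteSpace S] [TopologicalSpace.SeparableSpace S]
    [MeasurableSpace S] [BorelSpace S]
    (μ : Measure S) [SigmaFinite μ]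
    (T : ℝ) (hT : 0 < T) (h0 : (0:ℝ) ∈ Set.Icc (0:ℝ) T) (hTm : T ∈ Set.Icc (0:ℝ) T)
    (p : ℝ → S → S → ℝ≥0∞)
    -- `p` is a substochastic transition function on `S`:
    (hpMeas : ∀ t : ℝ, 0 < t → t ≤ T → Measurable (Function.uncurry (p t)))
    (hpSub : ∀ t : ℝ, 0 < t → t ≤ T → ∀ x : S, ∫⁻ y, p t y x ∂μ ≤ 1)
    (hpCK : ∀ s t : ℝ, 0 < s → 0 < t → s + t ≤ T →
      ∀ x z : S, ∫⁻ y, p t z y * p s y x ∂μ = p (t + s) z x)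
    -- the Wiener measures and the conditional Wiener measures exist for all
    -- `x₀, y₀ ∈ S`:
    (W : (x₀ : S) → Measure (PathSpace S T h0 x₀))
    (hW : ∀ x₀ : S, IsWienerMeasure μ p T h0 x₀ (W x₀))
    (Wb : (x₀ y₀ : S) → Measure (BridgeSpace S T h0 hTm x₀ y₀))
    (hWb : ∀ x₀ y₀ : S, IsCondWienerMeasure μ p T h0 hTm x₀ y₀ (Wb x₀ y₀))
    (x₀ : S) :
    -- the nonnegative measurable case:
    (∀ f : PathSpace S T h0 x₀ → ℝ≥0∞, Measurable f →
      ∫⁻ w, f w ∂(W x₀)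
        = ∫⁻ y₀, ∫⁻ w : BridgeSpace S T h0 hTm x₀ y₀, f ⟨w.1, w.2.1⟩ ∂(Wb x₀ y₀) ∂μ) ∧
    -- the integrable case:
    (∀ f : PathSpace S T h0 x₀ → ℝ, Integrable f (W x₀) →
      ∫ w, f w ∂(W x₀)
        = ∫ y₀, ∫ w : BridgeSpace S T h0 hTm x₀ y₀, f ⟨w.1, w.2.1⟩ ∂(Wb x₀ y₀) ∂μ) := by
  have hfin : ∀ᵐ y ∂μ, p T y x₀ < ∞ := by
    refine ae_lt_top ?_ ((hpSub T hT le_rfl x₀).trans_lt ENNReal.one_lt_top).ne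
    exact (hpMeas T hT le_rfl).comp (measurable_id.prodMk measurable_const)
  have hpm : MeasurableSet {y | p T y x₀ < ∞} :=
    measurableSet_lt ((hpMeas T hT le_rfl).comp (measurable_id.prodMk measurable_const))
      measurable_const
  have hmass : ∀ y, Wb x₀ y Set.univ = p T y x₀ := fun y ↦
    condWiener_univ hT hpMeas hpCK (hWb x₀ y)
  have hcyl := fun A (hA : A ∈ cylinders S h0 hTm x₀) ↦
    wiener_cylinder hT hpMeas (hW x₀) (fun y ↦ hWb x₀ y) hA
  classical
  let κ : S → Measure (PathSpace S T h0 x₀) := fun y ↦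
    if p T y x₀ < ∞ then (Wb x₀ y).map (bridgeToPath h0 hTm x₀ y) else 0
  have hκfin : ∀ y, IsFiniteMeasure (κ y) := fun y ↦ by
    constructor
    by_cases h : p T y x₀ < ∞
    · simp [κ, h, Measure.map_apply (measurable_bridgeToPath h0 hTm x₀ y) MeasurableSet.univ,
        hmass]
    · simp [κ, h]
  have hκae : ∀ᵐ y ∂μ, κ y = (Wb x₀ y).map (bridgeToPath h0 hTm x₀ y) := by
    filter_upwards [hfin] with y hy
    simp [κ, hy]
  have hgen := generateFrom_cylinders (S := S) hT h0 hTm x₀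
  have hpi := isPiSystem_cylinders (S := S) h0 hTm x₀
  have hAm : ∀ A ∈ cylinders S h0 hTm x₀, MeasurableSet A := fun A hA ↦ by
    have := MeasurableSpace.measurableSet_generateFrom hA
    rwa [← hgen] at this
  have huniv := univ_mem_cylinders (S := S) hT h0 hTm x₀
  have hκcyl : ∀ A ∈ cylinders S h0 hTm x₀, Measurable fun y ↦ κ y A := fun A hA ↦ by
    have : (fun y ↦ κ y A) = {y | p T y x₀ < ∞}.indicator
        (fun y ↦ Wb x₀ y (bridgeToPath h0 hTm x₀ y ⁻¹' A)) := by
      ext y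
      by_cases h : p T y x₀ < ∞
      · simp [κ, h, Measure.map_apply (measurable_bridgeToPath h0 hTm x₀ y) (hAm A hA)]
      · simp [κ, h]
    rw [this]
    exact (hcyl A hA).1.indicator hpm
  have hκ : Measurable κ := Measurable.measure_of_isPiSystem hgen hpi hκcyl (hκcyl _ huniv)
  have hval : ∀ A ∈ cylinders S h0 hTm x₀, W x₀ A = μ.bind κ A := fun A hA ↦ by
    rw [Measure.bind_apply (hAm A hA) hκ.aemeasurable, (hcyl A hA).2]
    refine lintegral_congr_ae ?_
    filter_upwards [hκae] with y hy
    rw [hy, Measure.map_apply (measurable_bridgeToPath h0 hTm x₀ y) (hAm A hA)]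
  have hWfin : IsFiniteMeasure (W x₀) := by
    constructor
    rw [(hcyl _ huniv).2]
    simp only [Set.preimage_univ, hmass]
    exact (hpSub T hT le_rfl x₀).trans_lt ENNReal.one_lt_top
  have hbind : W x₀ = μ.bind κ :=
    ext_of_generate_finite _ hgen hpi hval (hval _ huniv)
  refine ⟨fun f hf ↦ ?_, fun f hf ↦ ?_⟩
  · rw [hbind, Measure.lintegral_bind hκ.aemeasurable hf.aemeasurable]
    refine lintegral_congr_ae ?_
    filter_upwards [hκae] with y hy
    rw [hy, lintegral_map hf (measurable_bridgeToPath h0 hTm x₀ y)]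
    rfl
  · rw [hbind] at hf ⊢
    rw [integral_bind hκ hf]
    refine integral_congr_ae ?_
    filter_upwards [hκae, Measure.ae_ae_of_ae_bind hκ.aemeasurable hf.1.ae_eq_mk] with y hy hae
    rw [hy] at hae ⊢
    rw [integral_map (measurable_bridgeToPath h0 hTm x₀ y).aemeasurable
      ⟨_, hf.1.stronglyMeasurable_mk, hae⟩]
    rfl

end
end

section
/- Let (S,ρ,μ) be a metric measure space, let T > 0, let p be a substochastic transition function on S, fix x₀ ∈ S, and suppose the Wiener measure 𝕎_{x₀} on C_{x₀}([0,T];S) induced by p exists. Let B be a Borel subset of S with μ(B) = 0 and let λ denote Lebesgue measure on [0,T]. Then the set W_B := {w ∈ C_{x₀}([0,T];S) : λ(w^{−1}(B)) = 0} has full measure; that is, its complement C_{x₀}([0,T];S) \ W_B is a 𝕎_{x₀}-null set. -/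
open MeasureTheory Filter Topology
open scoped ENNReal NNReal

noncomputable section

instance (S : Type) [TopologicalSpace S] (T : ℝ)
    (h0 : (0:ℝ) ∈ Set.Icc (0:ℝ) T) (x₀ : S) :
    BorelSpace (PathSpace S T h0 x₀) := ⟨rfl⟩

namespace IsWienerMeasure

variable {S : Type} [TopologicalSpace S] [MeasurableSpace S]
  {μ : Measure S} {p : ℝ → S → S → ℝ≥0∞} {T : ℝ}
  {h0 : (0:ℝ) ∈ Set.Icc (0:ℝ) T} {x₀ : S} {W : Measure (PathSpace S T h0 x₀)}

/-- The total mass of a Wiener measure is the mass of the transition function at time `T`. -/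
theorem measure_univ_eq (hW : IsWienerMeasure μ p T h0 x₀ W) (hT : 0 < T) :
    W Set.univ = ∫⁻ y, p T y x₀ ∂μ := by
  have h := hW 1 one_pos (fun i => i * T) (by simp) (by simpa using hT) (by simp)
    (fun i hi => by interval_cases i <;> simp [hT.le]) (fun _ => Set.univ) (fun _ => isOpen_univ)
  simp only [Set.mem_univ, implies_true, Set.ofPred_true, Set.pi_univ, Measure.restrict_univ] at h
  rw [h, ← (measurePreserving_funUnique μ (Fin 1)).lintegral_comp_emb
    (MeasurableEquiv.funUnique (Fin 1) S).measurableEmbedding]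
  simp only [pathOf, Finset.range_one, Finset.prod_singleton]
  congr!
  simp

/-- At an intermediate time, the law of the path under a finite Wiener measure does not charge
`μ`-null Borel sets. -/
theorem measure_eval_mem_eq_zero [BorelSpace S] [SigmaFinite μ] [IsFiniteMeasure W]
    (hW : IsWienerMeasure μ p T h0 x₀ W) {s : ℝ} (hs : s ∈ Set.Ioo 0 T)
    {B : Set S} (hB : MeasurableSet B) (hBnull : μ B = 0) :
    W {w | w.1 ⟨s, Set.Ioo_subset_Icc_self hs⟩ ∈ B} = 0 := by
  let t : ℕ → ℝ := fun i => if i = 0 then 0 else if i = 1 then s else T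
  let f : (Fin 2 → S) → ℝ≥0∞ := fun x => ∏ i ∈ Finset.range 2,
    p (t (i + 1) - t i) (pathOf x₀ 2 x (i + 1)) (pathOf x₀ 2 x i)
  let ν : Measure S := ((Measure.pi fun _ : Fin 2 => μ).withDensity f).map (Function.eval 0)
  have hev : Measurable fun w : PathSpace S T h0 x₀ => w.1 ⟨s, Set.Ioo_subset_Icc_self hs⟩ :=
    ((continuous_eval_const _).comp continuous_subtype_val).measurable
  have hopen (U : Set S) (hU : IsOpen U) :
      W.map (fun w => w.1 ⟨s, Set.Ioo_subset_Icc_self hs⟩) U = ν U := by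
    have h := hW 2 two_pos t (by simp [t])
      (fun i hi => by interval_cases i <;> simp [t, hs.1, hs.2]) (by simp [t])
      (fun i hi => by
        interval_cases i <;> simp [t, hs.1.le, hs.2.le, (hs.1.trans hs.2).le])
      ![U, Set.univ] (fun i => by fin_cases i <;> simp [hU])
    have hpi : Set.univ.pi ![U, Set.univ] = Function.eval (0 : Fin 2) ⁻¹' U := by
      ext x
      simp [Fin.forall_fin_two]
    rw [Measure.map_apply hev hU.measurableSet,
      Measure.map_apply (measurable_pi_apply 0) hU.measurableSet,
      withDensity_apply _ (measurable_pi_apply 0 hU.measurableSet), ← hpi, ← h]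
    congr 1
    ext w
    simp [Fin.forall_fin_two, t]
  have hlaw : W.map (fun w => w.1 ⟨s, Set.Ioo_subset_Icc_self hs⟩) = ν :=
    ext_of_generate_finite _ BorelSpace.measurable_eq isPiSystem_isOpen hopen
      (hopen _ isOpen_univ)
  have hnull : ν B = 0 := by
    rw [Measure.map_apply (measurable_pi_apply 0) hB]
    exact withDensity_absolutelyContinuous _ _ (Measure.pi_eval_preimage_null _ hBnull)
  rwa [← hlaw, Measure.map_apply hev hB] at hnull

end IsWienerMeasure

/-- Lemma 2.20: if `B ⊂ S` is a `μ`-null Borel set, then `𝕎_{x₀}`-almost every path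
spends (Lebesgue-)almost no time in `B`. -/
theorem wiener_avoids_null_sets
    {S : Type} [MetricSpace S] [CompleteSpace S] [TopologicalSpace.SeparableSpace S]
    [MeasurableSpace S] [BorelSpace S]
    (μ : Measure S) [SigmaFinite μ]
    (T : ℝ) (hT : 0 < T) (h0 : (0:ℝ) ∈ Set.Icc (0:ℝ) T)
    (p : ℝ → S → S → ℝ≥0∞)
    -- `p` is a substochastic transition function on `S`:
    (hpMeas : ∀ t : ℝ, 0 < t → t ≤ T → Measurable (Function.uncurry (p t)))
    (hpSub : ∀ t : ℝ, 0 < t → t ≤ T → ∀ x : S, ∫⁻ y, p t y x ∂μ ≤ 1)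
    (hpCK : ∀ s t : ℝ, 0 < s → 0 < t → s + t ≤ T →
      ∀ x z : S, ∫⁻ y, p t z y * p s y x ∂μ = p (t + s) z x)
    (x₀ : S)
    (W : Measure (PathSpace S T h0 x₀))
    (hW : IsWienerMeasure μ p T h0 x₀ W)
    (B : Set S) (hB : MeasurableSet B) (hBnull : μ B = 0) :
    W ({w : PathSpace S T h0 x₀ |
        volume {s : ℝ | ∃ h : s ∈ Set.Icc (0:ℝ) T, w.1 ⟨s, h⟩ ∈ B} = 0}ᶜ) = 0 := by
  have : IsFiniteMeasure W :=
    ⟨(hW.measure_univ_eq hT).trans_le (hpSub T hT le_rfl x₀) |>.trans_lt ENNReal.one_lt_top⟩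
  have : SecondCountableTopology S := UniformSpace.secondCountable_of_separable S
  let ev : PathSpace S T h0 x₀ × ℝ → S := fun q => q.1.1 (Set.projIcc 0 T hT.le q.2)
  have hev : Measurable ev := by
    refine Continuous.measurable ?_
    exact continuous_eval.comp ((continuous_subtype_val.comp continuous_fst).prodMk
      ((continuous_projIcc (h := hT.le)).comp continuous_snd))
  have hae : ∀ᵐ s ∂volume.restrict (Set.Icc 0 T), ∀ᵐ w ∂W, ev (w, s) ∉ B := by
    rw [← restrict_Ioo_eq_restrict_Icc]
    refine (ae_restrict_iff' measurableSet_Ioo).2 (Eventually.of_forall fun s hs => ?_)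
    simpa [ae_iff, ev, Set.projIcc_of_mem hT.le (Set.Ioo_subset_Icc_self hs)] using
      hW.measure_eval_mem_eq_zero hs hB hBnull
  rw [← Measure.ae_ae_comm (p := fun w s => ev (w, s) ∉ B) (hev hB.compl)] at hae
  change ∀ᵐ w ∂W, volume {s : ℝ | ∃ h : s ∈ Set.Icc (0:ℝ) T, w.1 ⟨s, h⟩ ∈ B} = 0
  filter_upwards [hae] with w hw
  rw [ae_restrict_iff' measurableSet_Icc, ae_iff] at hw
  refine measure_mono_null (fun s => ?_) hw
  rintro ⟨h, hs⟩
  simpa [ev, h.1, h.2, Set.projIcc_of_mem hT.le h] using hs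

end
end

section
/- For t > 0 and x, y ∈ ℝ define the Cauchy kernel p_t(x,y) := t / (π(t² + (x−y)²)). Then: (1) for all t > 0 and x ∈ ℝ, ∫_ℝ p_t(y,x) dy = 1; (2) for all s, t > 0 and x, z ∈ ℝ, the Chapman–Kolmogorov identity holds: ∫_ℝ p_t(z,y)·p_s(y,x) dy = p_{t+s}(z,x). -/
open MeasureTheory

open Filter Topology

theorem Real.tendsto_arctan_sub_div_atTop {c : ℝ} (hc : 0 < c) (z : ℝ) :
    Tendsto (fun y : ℝ => Real.arctan ((y - z) / c)) atTop (𝓝 (Real.pi / 2)) :=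
  (tendsto_nhds_of_tendsto_nhdsWithin Real.tendsto_arctan_atTop).comp
    ((tendsto_atTop_add_const_right _ (-z) tendsto_id).atTop_div_const hc)

theorem Real.tendsto_arctan_sub_div_atBot {c : ℝ} (hc : 0 < c) (z : ℝ) :
    Tendsto (fun y : ℝ => Real.arctan ((y - z) / c)) atBot (𝓝 (-(Real.pi / 2))) :=
  (tendsto_nhds_of_tendsto_nhdsWithin Real.tendsto_arctan_atBot).comp
    ((tendsto_atBot_add_const_right _ (-z) tendsto_id).atBot_div_const hc)

theorem Real.hasDerivAt_arctan_sub_div {c : ℝ} (hc : 0 < c) (z y : ℝ) :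
    HasDerivAt (fun y : ℝ => Real.arctan ((y - z) / c)) (c / (c ^ 2 + (y - z) ^ 2)) y := by
  have h := (((hasDerivAt_id y).sub_const z).div_const c).arctan
  simp only [id] at h
  convert h using 1
  field_simp

theorem integrable_inv_sq_add_sq {c : ℝ} (hc : 0 < c) (z : ℝ) :
    Integrable (fun y : ℝ => (c ^ 2 + (y - z) ^ 2)⁻¹) := by
  have h := ((integrable_inv_one_add_sq.comp_div hc.ne').comp_sub_right z).const_mul (c ^ 2)⁻¹
  refine h.congr (Eventually.of_forall fun y => ?_)
  simp only
  field_simp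

theorem integral_univ_div_sq_add_sq {c : ℝ} (hc : 0 < c) (z : ℝ) :
    ∫ y : ℝ, c / (c ^ 2 + (y - z) ^ 2) = Real.pi := by
  rw [integral_of_hasDerivAt_of_tendsto (Real.hasDerivAt_arctan_sub_div hc z)
    ((integrable_inv_sq_add_sq hc z).const_mul c) (Real.tendsto_arctan_sub_div_atBot hc z)
    (Real.tendsto_arctan_sub_div_atTop hc z)]
  ring

theorem integrable_inv_sq_add_sq_mul_sq_add_sq {s t : ℝ} (hs : 0 < s) (ht : 0 < t) (x z : ℝ) :
    Integrable (fun y : ℝ => ((t ^ 2 + (y - z) ^ 2) * (s ^ 2 + (y - x) ^ 2))⁻¹) := by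
  refine ((integrable_inv_sq_add_sq hs x).const_mul (t ^ 2)⁻¹).mono'
    (by fun_prop) (Eventually.of_forall fun y => ?_)
  rw [Real.norm_of_nonneg (by positivity), ← mul_inv]
  gcongr
  nlinarith [sq_nonneg (y - z)]

theorem tendsto_sq_add_sq_div_sq_add_sq {l : Filter ℝ} (hl : Tendsto (fun y : ℝ => y⁻¹) l (𝓝 0))
    (h0 : ∀ᶠ y : ℝ in l, y ≠ 0) (s t x z : ℝ) :
    Tendsto (fun y : ℝ => (t ^ 2 + (y - z) ^ 2) / (s ^ 2 + (y - x) ^ 2)) l (𝓝 1) := by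
  have hF : ContinuousAt (fun w : ℝ => ((t * w) ^ 2 + (1 - z * w) ^ 2) /
      ((s * w) ^ 2 + (1 - x * w) ^ 2)) 0 := by
    apply ContinuousAt.div (by fun_prop) (by fun_prop)
    norm_num
  have h := hF.tendsto.comp hl
  norm_num at h
  refine h.congr' ?_
  filter_upwards [h0] with y hy
  have e (c u : ℝ) : (c * y⁻¹) ^ 2 + (1 - u * y⁻¹) ^ 2 = (c ^ 2 + (y - u) ^ 2) / y ^ 2 := by
    field_simp
  simp only [Function.comp, e]
  exact div_div_div_cancel_right₀ (by positivity) _ _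

theorem tendsto_sub_div_sq_add_sq {l : Filter ℝ} (hl : Tendsto (fun y : ℝ => y⁻¹) l (𝓝 0))
    (h0 : ∀ᶠ y : ℝ in l, y ≠ 0) (t z : ℝ) :
    Tendsto (fun y : ℝ => (y - z) / (t ^ 2 + (y - z) ^ 2)) l (𝓝 0) := by
  have hF : ContinuousAt (fun w : ℝ => w * (1 - z * w) / ((t * w) ^ 2 + (1 - z * w) ^ 2)) 0 := by
    apply ContinuousAt.div (by fun_prop) (by fun_prop)
    norm_num
  have h := hF.tendsto.comp hl
  norm_num at h
  refine h.congr' ?_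
  filter_upwards [h0] with y hy
  have e : (t * y⁻¹) ^ 2 + (1 - z * y⁻¹) ^ 2 = (t ^ 2 + (y - z) ^ 2) / y ^ 2 := by
    field_simp
  have e' : y⁻¹ * (1 - z * y⁻¹) = (y - z) / y ^ 2 := by
    field_simp
  simp only [Function.comp, e, e']
  exact div_div_div_cancel_right₀ (by positivity) _ _

theorem integral_inv_sq_add_sq_sq {t : ℝ} (ht : 0 < t) (z : ℝ) :
    ∫ y : ℝ, ((t ^ 2 + (y - z) ^ 2) * (t ^ 2 + (y - z) ^ 2))⁻¹ = Real.pi / (2 * t ^ 3) := by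
  have hd (y : ℝ) : HasDerivAt (fun y : ℝ => (2 * t ^ 2)⁻¹ * ((y - z) / (t ^ 2 + (y - z) ^ 2)) +
      (2 * t ^ 3)⁻¹ * Real.arctan ((y - z) / t))
      ((t ^ 2 + (y - z) ^ 2) * (t ^ 2 + (y - z) ^ 2))⁻¹ y := by
    have hP : t ^ 2 + (y - z) ^ 2 ≠ 0 := by positivity
    have hu := (hasDerivAt_id y).sub_const z
    refine (((hu.div ((hu.pow 2).const_add (t ^ 2)) hP).const_mul (2 * t ^ 2)⁻¹).add
      ((Real.hasDerivAt_arctan_sub_div ht z y).const_mul (2 * t ^ 3)⁻¹)).congr_deriv ?_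
    simp only [id, Pi.pow_apply]
    field_simp
    ring
  have hlim {l : Filter ℝ} (hl : Tendsto (fun y : ℝ => y⁻¹) l (𝓝 0)) (h0 : ∀ᶠ y : ℝ in l, y ≠ 0) :=
    (tendsto_sub_div_sq_add_sq hl h0 t z).const_mul (2 * t ^ 2)⁻¹
  rw [integral_of_hasDerivAt_of_tendsto hd (integrable_inv_sq_add_sq_mul_sq_add_sq ht ht z z)
    ((hlim tendsto_inv_atBot_zero (eventually_ne_atBot 0)).add
      ((Real.tendsto_arctan_sub_div_atBot ht z).const_mul _))
    ((hlim tendsto_inv_atTop_zero (eventually_ne_atTop 0)).add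
      ((Real.tendsto_arctan_sub_div_atTop ht z).const_mul _))]
  field_simp
  ring

theorem integral_inv_sq_add_sq_mul_sq_add_sq_of_ne {s t x z : ℝ} (hs : 0 < s) (ht : 0 < t)
    (hne : (z - x) ^ 2 + (s - t) ^ 2 ≠ 0) :
    ∫ y : ℝ, ((t ^ 2 + (y - z) ^ 2) * (s ^ 2 + (y - x) ^ 2))⁻¹ =
      Real.pi * (t + s) / (t * s * ((t + s) ^ 2 + (z - x) ^ 2)) := by
  have hne' : (t + s) ^ 2 + (z - x) ^ 2 ≠ 0 := by positivity
  set R : ℝ := ((z - x) ^ 2 + (s - t) ^ 2) * ((t + s) ^ 2 + (z - x) ^ 2) with hR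
  have hR0 : R ≠ 0 := mul_ne_zero hne hne'
  have hd (y : ℝ) : HasDerivAt (fun y : ℝ =>
      -((z - x) / R) * Real.log ((t ^ 2 + (y - z) ^ 2) / (s ^ 2 + (y - x) ^ 2)) +
      ((z - x) ^ 2 + s ^ 2 - t ^ 2) / (R * t) * Real.arctan ((y - z) / t) +
      ((z - x) ^ 2 + t ^ 2 - s ^ 2) / (R * s) * Real.arctan ((y - x) / s))
      ((t ^ 2 + (y - z) ^ 2) * (s ^ 2 + (y - x) ^ 2))⁻¹ y := by
    have hP : t ^ 2 + (y - z) ^ 2 ≠ 0 := by positivity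
    have hQ : s ^ 2 + (y - x) ^ 2 ≠ 0 := by positivity
    have hu := (((hasDerivAt_id y).sub_const z).pow 2).const_add (t ^ 2)
    have hv := (((hasDerivAt_id y).sub_const x).pow 2).const_add (s ^ 2)
    refine (((((hu.div hv hQ).log (div_ne_zero hP hQ)).const_mul (-((z - x) / R))).add
      ((Real.hasDerivAt_arctan_sub_div ht z y).const_mul
        (((z - x) ^ 2 + s ^ 2 - t ^ 2) / (R * t)))).add
      ((Real.hasDerivAt_arctan_sub_div hs x y).const_mul
        (((z - x) ^ 2 + t ^ 2 - s ^ 2) / (R * s)))).congr_deriv ?_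
    simp only [id, Pi.div_apply, Pi.pow_apply]
    field_simp
    rw [hR]
    ring
  have hlim {l : Filter ℝ} (hl : Tendsto (fun y : ℝ => y⁻¹) l (𝓝 0)) (h0 : ∀ᶠ y : ℝ in l, y ≠ 0) :=
    ((tendsto_sq_add_sq_div_sq_add_sq hl h0 s t x z).log one_ne_zero).const_mul (-((z - x) / R))
  rw [integral_of_hasDerivAt_of_tendsto hd (integrable_inv_sq_add_sq_mul_sq_add_sq hs ht x z)
    (((hlim tendsto_inv_atBot_zero (eventually_ne_atBot 0)).add
      ((Real.tendsto_arctan_sub_div_atBot ht z).const_mul _)).add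
      ((Real.tendsto_arctan_sub_div_atBot hs x).const_mul _))
    (((hlim tendsto_inv_atTop_zero (eventually_ne_atTop 0)).add
      ((Real.tendsto_arctan_sub_div_atTop ht z).const_mul _)).add
      ((Real.tendsto_arctan_sub_div_atTop hs x).const_mul _))]
  rw [Real.log_one, hR]
  field_simp
  ring

theorem integral_inv_sq_add_sq_mul_sq_add_sq {s t : ℝ} (hs : 0 < s) (ht : 0 < t) (x z : ℝ) :
    ∫ y : ℝ, ((t ^ 2 + (y - z) ^ 2) * (s ^ 2 + (y - x) ^ 2))⁻¹ =
      Real.pi * (t + s) / (t * s * ((t + s) ^ 2 + (z - x) ^ 2)) := by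
  by_cases hne : (z - x) ^ 2 + (s - t) ^ 2 = 0
  · obtain rfl : z = x := by nlinarith [sq_nonneg (z - x), sq_nonneg (s - t)]
    obtain rfl : s = t := by nlinarith [sq_nonneg (s - t)]
    rw [integral_inv_sq_add_sq_sq hs]
    field_simp
    ring
  · exact integral_inv_sq_add_sq_mul_sq_add_sq_of_ne hs ht hne

/-- Example 2.14 (the Cauchy kernel): the Cauchy kernel
`p_t(x,y) = t/(π(t² + (x−y)²))` has total mass one and satisfies the
Chapman–Kolmogorov identity. -/
theorem cauchy_kernel_transition_function :
    -- (1) total mass one: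
    (∀ t : ℝ, 0 < t → ∀ x : ℝ,
      ∫ y : ℝ, t / (Real.pi * (t ^ 2 + (x - y) ^ 2)) = 1) ∧
    -- (2) Chapman–Kolmogorov:
    (∀ s t : ℝ, 0 < s → 0 < t → ∀ x z : ℝ,
      ∫ y : ℝ, (t / (Real.pi * (t ^ 2 + (z - y) ^ 2))) *
               (s / (Real.pi * (s ^ 2 + (y - x) ^ 2)))
        = (t + s) / (Real.pi * ((t + s) ^ 2 + (z - x) ^ 2))) := by
  refine ⟨fun t ht x => ?_, fun s t hs ht x z => ?_⟩
  · have h (y : ℝ) : t / (Real.pi * (t ^ 2 + (x - y) ^ 2)) =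
        Real.pi⁻¹ * (t / (t ^ 2 + (y - x) ^ 2)) := by
      rw [← neg_sub y x, neg_sq]
      field_simp
    simp only [h]
    rw [integral_const_mul, integral_univ_div_sq_add_sq ht, inv_mul_cancel₀ Real.pi_ne_zero]
  · have h (y : ℝ) : t / (Real.pi * (t ^ 2 + (z - y) ^ 2)) *
        (s / (Real.pi * (s ^ 2 + (y - x) ^ 2))) =
        t * s / Real.pi ^ 2 * ((t ^ 2 + (y - z) ^ 2) * (s ^ 2 + (y - x) ^ 2))⁻¹ := by
      rw [← neg_sub y z, neg_sq]
      field_simp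
    simp only [h]
    rw [integral_const_mul, integral_inv_sq_add_sq_mul_sq_add_sq hs ht]
    field_simp
end

section
/- Let T > 0, let f : [0,T] → ℝ be twice continuously differentiable, and let C₁, C₂ > 0 be constants such that f''(t) ≥ −C₁²·f(t) for all t ∈ [0,T], f'(0) ≥ −C₂·f(0), and f(0) > 0. Then for all t ∈ [0, T'], where T' = min{T, arctan(C₁/C₂)/C₁}, one has f(t) ≥ f(0)·(cos(C₁ t) − (C₂/C₁)·sin(C₁ t)). -/
open Set Real in
/-- If `f'' + c² f ≥ 0` on `[0, t]` and `0 ≤ c t ≤ π`, then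
`s ↦ f' s * sin (c (t - s)) + c * f s * cos (c (t - s))` is monotone on `[0, t]`; this is the
resulting inequality between its endpoint values. -/
lemma deriv_mul_sin_add_mul_cos_le {f f' f'' : ℝ → ℝ} {c t : ℝ} (ht : 0 ≤ t) (hc : 0 ≤ c)
    (hct : c * t ≤ π)
    (hf' : ∀ s ∈ Icc 0 t, HasDerivWithinAt f (f' s) (Icc 0 t) s)
    (hf'' : ∀ s ∈ Icc 0 t, HasDerivWithinAt f' (f'' s) (Icc 0 t) s)
    (hode : ∀ s ∈ Icc 0 t, -c ^ 2 * f s ≤ f'' s) :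
    f' 0 * sin (c * t) + c * f 0 * cos (c * t) ≤ c * f t := by
  have hderiv : ∀ s ∈ Icc 0 t, HasDerivWithinAt
      (fun s ↦ f' s * sin (c * (t - s)) + c * f s * cos (c * (t - s)))
      ((f'' s + c ^ 2 * f s) * sin (c * (t - s))) (Icc 0 t) s := by
    intro s hs
    have hlin : HasDerivWithinAt (fun s ↦ c * (t - s)) (c * (-1)) (Icc 0 t) s :=
      ((hasDerivWithinAt_id s _).const_sub t).const_mul c
    refine (((hf'' s hs).mul hlin.sin).add (((hf' s hs).const_mul c).mul hlin.cos)).congr_deriv ?_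
    ring
  have hmono : MonotoneOn
      (fun s ↦ f' s * sin (c * (t - s)) + c * f s * cos (c * (t - s))) (Icc 0 t) := by
    refine monotoneOn_of_hasDerivWithinAt_nonneg (convex_Icc 0 t)
      (fun s hs ↦ (hderiv s hs).continuousWithinAt)
      (fun s hs ↦ (hderiv s (interior_subset hs)).mono interior_subset) fun s hs ↦ ?_
    have hs := interior_subset hs
    refine mul_nonneg (by linarith [hode s hs]) (sin_nonneg_of_nonneg_of_le_pi ?_ ?_)
    · exact mul_nonneg hc (sub_nonneg.2 hs.2)
    · nlinarith [mul_nonneg hc hs.1]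
  simpa using hmono (left_mem_Icc.2 ht) (right_mem_Icc.2 ht) ht

/-- Lemma C.2 (ODE comparison): if `f` is twice continuously differentiable on `[0,T]`
with `f'' ≥ −C₁²f`, `f'(0) ≥ −C₂ f(0)` and `f(0) > 0`, then
`f(t) ≥ f(0)(cos(C₁t) − (C₂/C₁) sin(C₁t))` on `[0, min{T, arctan(C₁/C₂)/C₁}]`. -/
theorem ode_comparison
    (T : ℝ) (hT : 0 < T) (f f' f'' : ℝ → ℝ)
    -- `f` is twice continuously differentiable on `[0,T]` (one-sided derivatives at the
    -- endpoints):
    (hf' : ∀ t ∈ Set.Icc (0:ℝ) T, HasDerivWithinAt f (f' t) (Set.Icc (0:ℝ) T) t)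
    (hf'' : ∀ t ∈ Set.Icc (0:ℝ) T, HasDerivWithinAt f' (f'' t) (Set.Icc (0:ℝ) T) t)
    (hcont : ContinuousOn f'' (Set.Icc (0:ℝ) T))
    (C₁ C₂ : ℝ) (hC₁ : 0 < C₁) (hC₂ : 0 < C₂)
    (hode : ∀ t ∈ Set.Icc (0:ℝ) T, f'' t ≥ -C₁ ^ 2 * f t)
    (hinit : f' 0 ≥ -C₂ * f 0)
    (hpos : 0 < f 0) :
    ∀ t ∈ Set.Icc (0:ℝ) (min T (Real.arctan (C₁ / C₂) / C₁)),
      f t ≥ f 0 * (Real.cos (C₁ * t) - (C₂ / C₁) * Real.sin (C₁ * t)) := by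
  rintro t ⟨ht0, ht⟩
  obtain ⟨htT, hta⟩ := le_min_iff.1 ht
  have hsub : Set.Icc 0 t ⊆ Set.Icc 0 T := Set.Icc_subset_Icc_right htT
  have hct : C₁ * t ≤ Real.pi := by
    have h := (le_div_iff₀ hC₁).1 hta
    linarith [Real.arctan_lt_pi_div_two (C₁ / C₂), Real.pi_pos]
  have key := deriv_mul_sin_add_mul_cos_le ht0 hC₁.le hct
    (fun s hs ↦ (hf' s (hsub hs)).mono hsub) (fun s hs ↦ (hf'' s (hsub hs)).mono hsub)
    (fun s hs ↦ hode s (hsub hs))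
  have hsin : 0 ≤ Real.sin (C₁ * t) :=
    Real.sin_nonneg_of_nonneg_of_le_pi (mul_nonneg hC₁.le ht0) hct
  refine le_of_mul_le_mul_left ?_ hC₁
  calc C₁ * (f 0 * (Real.cos (C₁ * t) - C₂ / C₁ * Real.sin (C₁ * t)))
      = -C₂ * f 0 * Real.sin (C₁ * t) + C₁ * f 0 * Real.cos (C₁ * t) := by
        field_simp
        ring
    _ ≤ f' 0 * Real.sin (C₁ * t) + C₁ * f 0 * Real.cos (C₁ * t) := by gcongr
    _ ≤ C₁ * f t := key
end
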